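/- arXiv:2312.15689 — 4 statements merged into one kernel-verified Lean document; each statement's English description precedes it below -/
import Mathlib

section
/- Let N ≥ 1 be an integer and let c_N = Γ(N/2)/π^{N/2}. Then lim_{t→0⁺} ( c_N ∫_{B_1(0) ∖ B_t(0)} (|x|² + t²)^{−N/2} dx + 2 ln t ) = q_N, where q_N = 2 ∫_1^∞ ( (r²+1)^{−N/2} − r^{−N} ) r^{N−1} dr. -/
open MeasureTheory Real Filter Topology Set Metric

noncomputable section

/-- The normalization constant `c_N = Γ(N/2)/π^(N/2)`. -/
def cN (N : ℕ) : ℝ := Real.Gamma ((N : ℝ) / 2) / Real.pi ^ ((N : ℝ) / 2)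

/-- The constant `q_N = 2 ∫_1^∞ ((r²+1)^{−N/2} − r^{−N}) r^{N−1} dr`. -/
def qN (N : ℕ) : ℝ :=
  2 * ∫ r in Set.Ioi (1 : ℝ), ((r ^ 2 + 1) ^ (-(N : ℝ) / 2) - r ^ (-(N : ℝ))) * r ^ ((N : ℝ) - 1)

/-- The constant `c_N` is twice the reciprocal of the area `N * vol (B_1)` of the unit sphere. -/
lemma cN_mul_sphere_area {N : ℕ} (hN : 1 ≤ N) :
    cN N * (N * volume.real (ball (0 : EuclideanSpace ℝ (Fin N)) 1)) = 2 := by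
  have hN' : (0 : ℝ) < N := by exact_mod_cast hN
  have : Nonempty (Fin N) := ⟨⟨0, hN⟩⟩
  have hG : 0 < Gamma ((N : ℝ) / 2) := Gamma_pos_of_pos (by positivity)
  have hsqrt : √π ^ N = π ^ ((N : ℝ) / 2) := by
    rw [sqrt_eq_rpow, ← rpow_natCast, ← rpow_mul pi_pos.le]
    congr 1
    ring
  have hpi : 0 < π ^ ((N : ℝ) / 2) := by positivity
  rw [cN, Measure.real, EuclideanSpace.volume_ball, Fintype.card_fin, ENNReal.toReal_mul,
    Gamma_add_one (by positivity), hsqrt, ENNReal.toReal_ofReal (by positivity)]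
  simp only [ENNReal.ofReal_one, one_pow, ENNReal.toReal_one, one_mul]
  field_simp

/-- Integral of a radial function over the annulus `B_b ∖ B_a` in polar coordinates. -/
lemma setIntegral_annulus_fun_norm {N : ℕ} (hN : 1 ≤ N) {a b : ℝ} (ha : 0 < a) (hab : a ≤ b)
    (f : ℝ → ℝ) :
    ∫ x in ball (0 : EuclideanSpace ℝ (Fin N)) b \ ball (0 : EuclideanSpace ℝ (Fin N)) a, f ‖x‖ =
      N * volume.real (ball (0 : EuclideanSpace ℝ (Fin N)) 1) *
        ∫ y in a..b, y ^ (N - 1) * f y := by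
  have : Nonempty (Fin N) := ⟨⟨0, hN⟩⟩
  have hind : (fun x : EuclideanSpace ℝ (Fin N) => (ball 0 b \ ball 0 a).indicator
      (fun x => f ‖x‖) x) = fun x => (Ico a b).indicator f ‖x‖ := by
    ext x
    simp only [indicator, Set.mem_sdiff, mem_ball_zero_iff, not_lt, Set.mem_Ico]
    congr 1
    exact propext and_comm
  rw [← integral_indicator (measurableSet_ball.diff measurableSet_ball), hind,
    integral_fun_norm_addHaar, finrank_euclideanSpace_fin, nsmul_eq_mul, smul_eq_mul, mul_assoc]
  have hind' : (fun y : ℝ => y ^ (N - 1) • (Ico a b).indicator f y) =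
      (Ico a b).indicator fun y => y ^ (N - 1) * f y := by
    ext y
    by_cases hy : y ∈ Ico a b <;> simp [hy]
  have hsub : Ico a b ⊆ Ioi 0 := fun y hy => ha.trans_le hy.1
  rw [hind', setIntegral_indicator measurableSet_Ico, inter_eq_self_of_subset_right hsub,
    intervalIntegral.integral_of_le hab, integral_Ico_eq_integral_Ioc]

/-- First order bound for `(1 + x) ^ (-p)` near `x = 0`. -/
lemma one_sub_le_one_add_rpow_neg {x p : ℝ} (hx : 0 ≤ x) (hp : 0 ≤ p) :
    1 - p * x ≤ (1 + x) ^ (-p) := by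
  have hlog : log (1 + x) ≤ x := by linarith [log_le_sub_one_of_pos (by linarith : 0 < 1 + x)]
  rw [rpow_def_of_pos (by linarith)]
  nlinarith [add_one_le_exp (log (1 + x) * -p), mul_le_mul_of_nonneg_left hlog hp]

lemma qN_integrand_eq {N : ℕ} {r : ℝ} (hr : 0 < r) :
    ((r ^ 2 + 1) ^ (-(N : ℝ) / 2) - r ^ (-(N : ℝ))) * r ^ ((N : ℝ) - 1) =
      (r ^ 2 + 1) ^ (-(N : ℝ) / 2) * r ^ ((N : ℝ) - 1) - r⁻¹ := by
  rw [sub_mul, ← rpow_add hr, ← rpow_neg_one]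
  congr 2
  ring

lemma continuousOn_qN_integrand (N : ℕ) :
    ContinuousOn (fun r : ℝ =>
      (r ^ 2 + 1) ^ (-(N : ℝ) / 2) * r ^ ((N : ℝ) - 1)) (Ioi 0) := by
  intro r hr
  have h₁ : r ^ 2 + 1 ≠ 0 := by positivity
  have h₂ : r ≠ 0 := ne_of_gt hr
  exact (ContinuousAt.mul ((by fun_prop : ContinuousAt (fun r : ℝ => r ^ 2 + 1) r).rpow_const
    (Or.inl h₁)) (continuousAt_id.rpow_const (Or.inl h₂))).continuousWithinAt

lemma integrableOn_qN_integrand (N : ℕ) :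
    IntegrableOn (fun r : ℝ =>
      ((r ^ 2 + 1) ^ (-(N : ℝ) / 2) - r ^ (-(N : ℝ))) * r ^ ((N : ℝ) - 1)) (Ioi 1) := by
  have hpow : IntegrableOn (fun r : ℝ => (N : ℝ) / 2 * r ^ (-3 : ℝ)) (Ioi 1) :=
    (integrableOn_Ioi_rpow_of_lt (by norm_num) one_pos).const_mul _
  have hsub : Ioi (1 : ℝ) ⊆ Ioi 0 := Ioi_subset_Ioi zero_le_one
  have hcont : ContinuousOn (fun r : ℝ =>
      (r ^ 2 + 1) ^ (-(N : ℝ) / 2) * r ^ ((N : ℝ) - 1) - r⁻¹) (Ioi 1) :=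
    ((continuousOn_qN_integrand N).mono hsub).sub
      (continuousOn_inv₀.mono fun r hr => ne_of_gt (hsub hr))
  refine Integrable.mono' hpow ((hcont.congr fun r hr => qN_integrand_eq
    (hsub hr)).aestronglyMeasurable measurableSet_Ioi) ?_
  refine (ae_restrict_mem measurableSet_Ioi).mono fun r hr => ?_
  have hr0 : 0 < r := hsub hr
  have hfac : (r ^ 2 + 1) ^ (-(N : ℝ) / 2) =
      r ^ (-(N : ℝ)) * (1 + (r ^ 2)⁻¹) ^ (-((N : ℝ) / 2)) := by
    have h : r ^ 2 + 1 = r ^ 2 * (1 + (r ^ 2)⁻¹) := by field_simp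
    rw [h, mul_rpow (by positivity) (by positivity), ← rpow_natCast, ← rpow_mul hr0.le]
    congr 2 <;> push_cast <;> ring
  have hle : (1 + (r ^ 2)⁻¹) ^ (-((N : ℝ) / 2)) ≤ 1 :=
    rpow_le_one_of_one_le_of_nonpos (le_add_of_nonneg_right (by positivity))
      (neg_nonpos.2 (by positivity))
  have hge := one_sub_le_one_add_rpow_neg (x := (r ^ 2)⁻¹) (p := (N : ℝ) / 2)
    (by positivity) (by positivity)
  have hinv : r ^ (-(N : ℝ)) * r ^ ((N : ℝ) - 1) = r⁻¹ := by
    rw [← rpow_add hr0, ← rpow_neg_one]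
    congr 1
    ring
  have hcube : r ^ (-3 : ℝ) = (r ^ 2)⁻¹ * r⁻¹ := by
    rw [rpow_neg hr0.le, ← mul_inv, ← pow_succ]
    norm_cast
  have heq : ((r ^ 2 + 1) ^ (-(N : ℝ) / 2) - r ^ (-(N : ℝ))) * r ^ ((N : ℝ) - 1) =
      -((1 - (1 + (r ^ 2)⁻¹) ^ (-((N : ℝ) / 2))) * r⁻¹) := by
    rw [hfac, ← hinv]
    ring
  rw [heq, norm_neg, norm_of_nonneg (mul_nonneg (by linarith) (by positivity)), hcube, ← mul_assoc]
  gcongr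
  linarith

lemma integral_annulus_profile_rescale {N : ℕ} (hN : 1 ≤ N) {t : ℝ} (ht : 0 < t) (ht1 : t ≤ 1) :
    ∫ y in t..1, y ^ (N - 1) * (y ^ 2 + t ^ 2) ^ (-(N : ℝ) / 2) =
      ∫ r in (1 : ℝ)..t⁻¹, (r ^ 2 + 1) ^ (-(N : ℝ) / 2) * r ^ ((N : ℝ) - 1) := by
  have hscale := intervalIntegral.mul_integral_comp_mul_left (a := 1) (b := t⁻¹) (c := t)
    (f := fun y => y ^ (N - 1) * (y ^ 2 + t ^ 2) ^ (-(N : ℝ) / 2))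
  rw [mul_one, mul_inv_cancel₀ ht.ne'] at hscale
  rw [← hscale, ← intervalIntegral.integral_const_mul]
  refine intervalIntegral.integral_congr fun r hr => ?_
  rw [uIcc_of_le ((one_le_inv₀ ht).2 ht1)] at hr
  have hr0 : 0 < r := one_pos.trans_le hr.1
  have h : (t * r) ^ 2 + t ^ 2 = t ^ 2 * (r ^ 2 + 1) := by ring
  have htpow : (t ^ 2) ^ (-(N : ℝ) / 2) = (t ^ N)⁻¹ := by
    rw [← rpow_natCast t 2, ← rpow_mul ht.le, ← rpow_natCast t N, ← rpow_neg ht.le]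
    congr 1
    push_cast
    ring
  have hrpow : r ^ ((N : ℝ) - 1) = r ^ (N - 1) := by
    rw [← rpow_natCast, Nat.cast_sub hN, Nat.cast_one]
  have hmul : t * t ^ (N - 1) = t ^ N := mul_pow_sub_one (by omega) t
  simp only [h, hrpow]
  rw [mul_rpow (by positivity) (by positivity), htpow, mul_pow, ← hmul]
  field_simp

lemma cN_mul_integral_annulus_add_log {N : ℕ} (hN : 1 ≤ N) {t : ℝ} (ht : 0 < t) (ht1 : t ≤ 1) :
    cN N * (∫ x in ball (0 : EuclideanSpace ℝ (Fin N)) 1 \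
        ball (0 : EuclideanSpace ℝ (Fin N)) t,
      (‖x‖ ^ 2 + t ^ 2) ^ (-(N : ℝ) / 2)) + 2 * log t =
    2 * ∫ r in (1 : ℝ)..t⁻¹,
      ((r ^ 2 + 1) ^ (-(N : ℝ) / 2) - r ^ (-(N : ℝ))) * r ^ ((N : ℝ) - 1) := by
  have hle : 1 ≤ t⁻¹ := (one_le_inv₀ ht).2 ht1
  have hsub : uIcc 1 t⁻¹ ⊆ Ioi 0 := by
    rw [uIcc_of_le hle]
    exact fun r hr => one_pos.trans_le hr.1
  rw [setIntegral_annulus_fun_norm hN ht ht1 fun y => (y ^ 2 + t ^ 2) ^ (-(N : ℝ) / 2),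
    ← mul_assoc, cN_mul_sphere_area hN, integral_annulus_profile_rescale hN ht ht1,
    intervalIntegral.integral_congr fun r hr => qN_integrand_eq (hsub hr),
    intervalIntegral.integral_sub ((continuousOn_qN_integrand N).mono hsub).intervalIntegrable
      (continuousOn_inv₀.mono fun r hr => ne_of_gt (hsub hr)).intervalIntegrable,
    integral_inv_of_pos one_pos (inv_pos.2 ht), div_one, log_inv]
  ring

/-- `c_N ∫_{B_1 ∖ B_t} (|x|²+t²)^{−N/2} dx + 2 ln t → q_N` as `t → 0⁺`. -/
theorem stmt14 (N : ℕ) (hN : 1 ≤ N) :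
    Tendsto (fun t : ℝ =>
        cN N * (∫ x in Metric.ball (0 : EuclideanSpace ℝ (Fin N)) 1 \
            Metric.ball (0 : EuclideanSpace ℝ (Fin N)) t,
          (‖x‖ ^ 2 + t ^ 2) ^ (-(N : ℝ) / 2)) + 2 * Real.log t)
      (𝓝[>] (0 : ℝ)) (𝓝 (qN N)) := by
  have hlim := (intervalIntegral_tendsto_integral_Ioi 1 (integrableOn_qN_integrand N)
    tendsto_inv_nhdsGT_zero).const_mul 2
  refine hlim.congr' ?_
  filter_upwards [Ioc_mem_nhdsGT one_pos] with t ht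
  exact (cN_mul_integral_annulus_add_log hN ht.1 ht.2).symm
end
end

section
/- Let q_N = 2 ∫_1^∞ ( (r²+1)^{−N/2} − r^{−N} ) r^{N−1} dr for integers N ≥ 1. Then q_1 = 2 ln 2 − 2 ln(1+√2), q_2 = −ln 2, and more generally: for N = 2m with integer m ≥ 1, q_{2m} = −ln 2 + Σ_{k=1}^{m−1} 1/(k 2^k) − Σ_{k=1}^{m−1} 1/k; for N = 2m+1 with integer m ≥ 0, q_{2m+1} = 2 ln 2 − 2 ln(1+√2) + Σ_{k=1}^{m} 2^{(3−2k)/2}/(2k−1) − Σ_{k=1}^{m} 2/(2k−1) (empty sums being zero). -/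
open MeasureTheory Real Filter Topology Set Finset

noncomputable section

/-- The integrand of `qN`, with a real exponent. -/
def radialIntegrand (s r : ℝ) : ℝ := ((r ^ 2 + 1) ^ (-s / 2) - r ^ (-s)) * r ^ (s - 1)

theorem qN_eq_integral_radialIntegrand (N : ℕ) :
    qN N = 2 * ∫ r in Set.Ioi (1 : ℝ), radialIntegrand N r := rfl

theorem tendsto_one_add_inv_sq_atTop :
    Tendsto (fun r : ℝ => 1 + (r ^ 2)⁻¹) atTop (𝓝 1) := by
  simpa using (tendsto_inv_atTop_zero.comp (tendsto_pow_atTop (α := ℝ) two_ne_zero)).const_add 1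

theorem rpow_neg_mul_rpow_sub_one {r : ℝ} (hr : 0 < r) (s : ℝ) :
    r ^ (-s) * r ^ (s - 1) = r⁻¹ := by
  rw [← rpow_add hr, ← rpow_neg_one]
  ring_nf

theorem radialIntegrand_nonpos {s r : ℝ} (hs : 0 ≤ s) (hr : 0 < r) : radialIntegrand s r ≤ 0 := by
  refine mul_nonpos_of_nonpos_of_nonneg (sub_nonpos.2 ?_) (by positivity)
  calc (r ^ 2 + 1) ^ (-s / 2) ≤ (r ^ 2) ^ (-s / 2) :=
        rpow_le_rpow_of_nonpos (by positivity) (by linarith) (by linarith)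
    _ = r ^ (-s) := by
        rw [← rpow_natCast, ← rpow_mul hr.le]
        congr 1
        push_cast
        ring

/-- The difference between consecutive integrands of the same parity. -/
theorem radialIntegrand_add_two {r : ℝ} (hr : 0 < r) (s : ℝ) :
    radialIntegrand (s + 2) r =
      radialIntegrand s r - r ^ (s - 1) * (r ^ 2 + 1) ^ (-s / 2 - 1) := by
  have hpos : (0 : ℝ) < r ^ 2 + 1 := by positivity
  have h1 : (r ^ 2 + 1) ^ (-s / 2) = (r ^ 2 + 1) ^ (-s / 2 - 1) * (r ^ 2 + 1) := by
    rw [← rpow_add_one hpos.ne']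
    ring_nf
  have h2 : r ^ (s + 2 - 1) = r ^ (s - 1) * r ^ 2 := by
    rw [← rpow_natCast r 2, ← rpow_add hr]
    congr 1
    push_cast
    ring
  have h3 : -(s + 2) / 2 = -s / 2 - 1 := by ring
  unfold radialIntegrand
  rw [sub_mul, sub_mul, rpow_neg_mul_rpow_sub_one hr, rpow_neg_mul_rpow_sub_one hr, h1, h2, h3]
  ring

theorem hasDerivAt_rpow_mul_sq_add_one_rpow {s r : ℝ} (hs : s ≠ 0) (hr : 0 < r) :
    HasDerivAt (fun x : ℝ => x ^ s * (x ^ 2 + 1) ^ (-s / 2) / s)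
      (r ^ (s - 1) * (r ^ 2 + 1) ^ (-s / 2 - 1)) r := by
  have hpos : (0 : ℝ) < r ^ 2 + 1 := by positivity
  have hsq : HasDerivAt (fun x : ℝ => x ^ 2 + 1) (2 * r) r := by
    simpa using (hasDerivAt_pow 2 r).add_const (1 : ℝ)
  have h := ((Real.hasDerivAt_rpow_const (p := s) (Or.inl hr.ne')).mul
    (hsq.rpow_const (p := -s / 2) (Or.inl hpos.ne'))).div_const s
  refine h.congr_deriv ?_
  have h1 : (r ^ 2 + 1) ^ (-s / 2) = (r ^ 2 + 1) ^ (-s / 2 - 1) * (r ^ 2 + 1) := by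
    rw [← rpow_add_one hpos.ne']
    ring_nf
  have h2 : r ^ s = r ^ (s - 1) * r := by
    rw [← rpow_add_one hr.ne']
    ring_nf
  rw [h1, h2]
  field_simp
  ring

theorem tendsto_rpow_mul_sq_add_one_rpow (s : ℝ) :
    Tendsto (fun x : ℝ => x ^ s * (x ^ 2 + 1) ^ (-s / 2) / s) atTop (𝓝 (1 / s)) := by
  have h := (tendsto_one_add_inv_sq_atTop.rpow_const (p := -s / 2)
    (Or.inl one_ne_zero)).div_const s
  rw [one_rpow] at h
  refine h.congr' ?_
  filter_upwards [eventually_gt_atTop 0] with x hx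
  have h1 : x ^ 2 + 1 = x ^ 2 * (1 + (x ^ 2)⁻¹) := by field_simp
  have h2 : (x ^ 2) ^ (-s / 2) = x ^ (-s) := by
    rw [← rpow_natCast, ← rpow_mul hx.le]
    congr 1
    push_cast
    ring
  rw [h1, mul_rpow (by positivity) (by positivity), h2, ← mul_assoc, ← rpow_add hx]
  simp

theorem integrableOn_Ioi_rpow_mul_sq_add_one_rpow {s : ℝ} (hs : s ≠ 0) :
    IntegrableOn (fun r : ℝ => r ^ (s - 1) * (r ^ 2 + 1) ^ (-s / 2 - 1)) (Set.Ioi 1) := by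
  refine integrableOn_Ioi_deriv_of_nonneg'
    (fun x hx => hasDerivAt_rpow_mul_sq_add_one_rpow hs (zero_lt_one.trans_le hx))
    (fun x hx => ?_) (tendsto_rpow_mul_sq_add_one_rpow s)
  have : (0 : ℝ) < x := zero_lt_one.trans hx
  positivity

theorem integral_Ioi_rpow_mul_sq_add_one_rpow {s : ℝ} (hs : s ≠ 0) :
    ∫ r in Set.Ioi (1 : ℝ), r ^ (s - 1) * (r ^ 2 + 1) ^ (-s / 2 - 1) =
      (1 - 2 ^ (-s / 2)) / s := by
  rw [integral_Ioi_of_hasDerivAt_of_tendsto'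
    (fun x hx => hasDerivAt_rpow_mul_sq_add_one_rpow hs (zero_lt_one.trans_le hx))
    (integrableOn_Ioi_rpow_mul_sq_add_one_rpow hs) (tendsto_rpow_mul_sq_add_one_rpow s)]
  norm_num
  ring

theorem hasDerivAt_arsinh_sub_log {r : ℝ} (hr : 0 < r) :
    HasDerivAt (fun x => arsinh x - Real.log x) (radialIntegrand 1 r) r := by
  refine ((hasDerivAt_arsinh r).sub (Real.hasDerivAt_log hr.ne')).congr_deriv ?_
  unfold radialIntegrand
  rw [sub_mul, rpow_neg_mul_rpow_sub_one hr, neg_div, rpow_neg (by positivity), ← sqrt_eq_rpow,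
    sub_self, rpow_zero, mul_one, add_comm]

theorem tendsto_arsinh_sub_log :
    Tendsto (fun x => arsinh x - Real.log x) atTop (𝓝 (Real.log 2)) := by
  have h := (tendsto_one_add_inv_sq_atTop.sqrt.const_add 1).log (by norm_num)
  rw [sqrt_one, one_add_one_eq_two] at h
  refine h.congr' ?_
  filter_upwards [eventually_gt_atTop 0] with x hx
  have h1 : 1 + x ^ 2 = x ^ 2 * (1 + (x ^ 2)⁻¹) := by
    field_simp
    ring
  rw [arsinh, h1, sqrt_mul (by positivity), sqrt_sq hx.le, ← mul_one_add,
    Real.log_mul hx.ne' (by positivity)]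
  ring

theorem hasDerivAt_log_sq_add_one_sub_log {r : ℝ} (hr : 0 < r) :
    HasDerivAt (fun x => Real.log (x ^ 2 + 1) / 2 - Real.log x) (radialIntegrand 2 r) r := by
  have hpos : (0 : ℝ) < r ^ 2 + 1 := by positivity
  have hsq : HasDerivAt (fun x : ℝ => x ^ 2 + 1) (2 * r) r := by
    simpa using (hasDerivAt_pow 2 r).add_const (1 : ℝ)
  refine (((hsq.log hpos.ne').div_const 2).sub (Real.hasDerivAt_log hr.ne')).congr_deriv ?_
  unfold radialIntegrand
  rw [sub_mul, rpow_neg_mul_rpow_sub_one hr, neg_div, div_self two_ne_zero, rpow_neg_one,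
    show (2 : ℝ) - 1 = 1 by norm_num, rpow_one]
  field_simp

theorem tendsto_log_sq_add_one_sub_log :
    Tendsto (fun x => Real.log (x ^ 2 + 1) / 2 - Real.log x) atTop (𝓝 0) := by
  have h := (tendsto_one_add_inv_sq_atTop.log one_ne_zero).div_const 2
  rw [Real.log_one, zero_div] at h
  refine h.congr' ?_
  filter_upwards [eventually_gt_atTop 0] with x hx
  have h1 : x ^ 2 + 1 = x ^ 2 * (1 + (x ^ 2)⁻¹) := by field_simp
  rw [h1, Real.log_mul (by positivity) (by positivity), Real.log_pow]
  push_cast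
  ring

theorem integrableOn_radialIntegrand_one : IntegrableOn (radialIntegrand 1) (Set.Ioi 1) :=
  integrableOn_Ioi_deriv_of_nonpos'
    (fun _ hx => hasDerivAt_arsinh_sub_log (zero_lt_one.trans_le hx))
    (fun _ hx => radialIntegrand_nonpos zero_le_one (zero_lt_one.trans hx))
    tendsto_arsinh_sub_log

theorem integrableOn_radialIntegrand_two : IntegrableOn (radialIntegrand 2) (Set.Ioi 1) :=
  integrableOn_Ioi_deriv_of_nonpos'
    (fun _ hx => hasDerivAt_log_sq_add_one_sub_log (zero_lt_one.trans_le hx))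
    (fun _ hx => radialIntegrand_nonpos zero_le_two (zero_lt_one.trans hx))
    tendsto_log_sq_add_one_sub_log

theorem integrableOn_radialIntegrand_add_two {s : ℝ} (hs : s ≠ 0)
    (h : IntegrableOn (radialIntegrand s) (Set.Ioi 1)) :
    IntegrableOn (radialIntegrand (s + 2)) (Set.Ioi 1) :=
  (h.sub (integrableOn_Ioi_rpow_mul_sq_add_one_rpow hs)).congr_fun
    (fun _ hr => (radialIntegrand_add_two (zero_lt_one.trans hr) s).symm) measurableSet_Ioi

theorem integrableOn_radialIntegrand (N : ℕ) :
    IntegrableOn (radialIntegrand (N + 1 : ℕ)) (Set.Ioi 1) := by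
  induction N using Nat.twoStepInduction with
  | zero => simpa using integrableOn_radialIntegrand_one
  | one => simpa using integrableOn_radialIntegrand_two
  | more n ih _ =>
    have h := integrableOn_radialIntegrand_add_two (by positivity) ih
    rwa [show ((n + 2 + 1 : ℕ) : ℝ) = ((n + 1 : ℕ) : ℝ) + 2 by push_cast; ring]

theorem qN_one : qN 1 = 2 * Real.log 2 - 2 * Real.log (1 + Real.sqrt 2) := by
  rw [qN_eq_integral_radialIntegrand, Nat.cast_one, integral_Ioi_of_hasDerivAt_of_tendsto'
    (fun _ hx => hasDerivAt_arsinh_sub_log (zero_lt_one.trans_le hx))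
    integrableOn_radialIntegrand_one tendsto_arsinh_sub_log, arsinh]
  norm_num
  ring

theorem qN_two : qN 2 = -Real.log 2 := by
  rw [qN_eq_integral_radialIntegrand, Nat.cast_ofNat, integral_Ioi_of_hasDerivAt_of_tendsto'
    (fun _ hx => hasDerivAt_log_sq_add_one_sub_log (zero_lt_one.trans_le hx))
    integrableOn_radialIntegrand_two tendsto_log_sq_add_one_sub_log]
  norm_num
  ring

theorem qN_add_two {N : ℕ} (hN : N ≠ 0) :
    qN (N + 2) = qN N - 2 * ((1 - 2 ^ (-(N : ℝ) / 2)) / N) := by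
  have hN' : (N : ℝ) ≠ 0 := Nat.cast_ne_zero.2 hN
  obtain ⟨n, rfl⟩ := Nat.exists_eq_succ_of_ne_zero hN
  rw [qN_eq_integral_radialIntegrand, qN_eq_integral_radialIntegrand,
    ← integral_Ioi_rpow_mul_sq_add_one_rpow hN', ← mul_sub,
    ← integral_sub (integrableOn_radialIntegrand n)
      (integrableOn_Ioi_rpow_mul_sq_add_one_rpow hN')]
  congr 1
  refine setIntegral_congr_fun measurableSet_Ioi fun r hr => ?_
  rw [Nat.cast_add, Nat.cast_ofNat]
  exact radialIntegrand_add_two (zero_lt_one.trans hr) _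

theorem qN_even (m : ℕ) :
    qN (2 * (m + 1)) = -Real.log 2 + (∑ k ∈ Finset.Icc 1 m, 1 / ((k : ℝ) * 2 ^ k))
      - ∑ k ∈ Finset.Icc 1 m, 1 / (k : ℝ) := by
  induction m with
  | zero => simp [qN_two]
  | succ m ih =>
    rw [mul_add_one, qN_add_two (by positivity), ih, Finset.sum_Icc_succ_top (by lia),
      Finset.sum_Icc_succ_top (by lia)]
    have h : (2 : ℝ) ^ (-((2 * (m + 1) : ℕ) : ℝ) / 2) = (2 ^ (m + 1))⁻¹ := by
      rw [← rpow_natCast, ← rpow_neg zero_le_two]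
      congr 1
      push_cast
      ring
    rw [h]
    push_cast
    field_simp
    ring

theorem qN_odd (m : ℕ) :
    qN (2 * m + 1) = 2 * Real.log 2 - 2 * Real.log (1 + Real.sqrt 2)
      + (∑ k ∈ Finset.Icc 1 m, (2 : ℝ) ^ ((3 - 2 * (k : ℝ)) / 2) / (2 * (k : ℝ) - 1))
      - ∑ k ∈ Finset.Icc 1 m, 2 / (2 * (k : ℝ) - 1) := by
  induction m with
  | zero => simp [qN_one]
  | succ m ih =>
    rw [mul_add_one, add_right_comm, qN_add_two (by positivity), ih,
      Finset.sum_Icc_succ_top (by lia), Finset.sum_Icc_succ_top (by lia)]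
    have h : (2 : ℝ) ^ ((3 - 2 * ((m + 1 : ℕ) : ℝ)) / 2) =
        2 ^ (-((2 * m + 1 : ℕ) : ℝ) / 2) * 2 := by
      rw [← rpow_add_one two_ne_zero]
      congr 1
      push_cast
      ring
    have h' : 2 * ((m + 1 : ℕ) : ℝ) - 1 = ((2 * m + 1 : ℕ) : ℝ) := by
      push_cast
      ring
    rw [h, h']
    ring

/-- explicit values of `q_N`. -/
theorem stmt16 :
    qN 1 = 2 * Real.log 2 - 2 * Real.log (1 + Real.sqrt 2) ∧
    qN 2 = -Real.log 2 ∧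
    (∀ m : ℕ, 1 ≤ m →
      qN (2 * m) = -Real.log 2 + (∑ k ∈ Finset.Icc 1 (m - 1), 1 / ((k : ℝ) * 2 ^ k))
        - ∑ k ∈ Finset.Icc 1 (m - 1), 1 / (k : ℝ)) ∧
    (∀ m : ℕ,
      qN (2 * m + 1) = 2 * Real.log 2 - 2 * Real.log (1 + Real.sqrt 2)
        + (∑ k ∈ Finset.Icc 1 m, (2 : ℝ) ^ ((3 - 2 * (k : ℝ)) / 2) / (2 * (k : ℝ) - 1))
        - ∑ k ∈ Finset.Icc 1 m, 2 / (2 * (k : ℝ) - 1)) := by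
  refine ⟨qN_one, qN_two, fun m hm => ?_, qN_odd⟩
  obtain ⟨n, rfl⟩ := Nat.exists_eq_add_of_le' hm
  simpa only [Nat.add_sub_cancel] using qN_even n
end
end

section
/- Let N ≥ 1 be an integer, and set q_N = 2 ∫_1^∞ ( (r²+1)^{−N/2} − r^{−N} ) r^{N−1} dr and q̃_N = 2 ∫_0^1 (r²+1)^{−N/2} r^{N−1} dr. Then q_N + q̃_N + ρ_N = 2 (ln 2 − γ), where ρ_N = 2 ln 2 + ψ(N/2) − γ; equivalently, q_N + q̃_N = − γ − ψ(N/2). -/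
open MeasureTheory Real Filter Topology Set

noncomputable section

/-- The constant `q̃_N = 2 ∫_0^1 (r²+1)^{−N/2} r^{N−1} dr`. -/
def qTildeN (N : ℕ) : ℝ :=
  2 * ∫ r in (0 : ℝ)..1, (r ^ 2 + 1) ^ (-(N : ℝ) / 2) * r ^ ((N : ℝ) - 1)

/-- The digamma function `ψ = Γ'/Γ`. -/
def digammaFn (x : ℝ) : ℝ := deriv Real.Gamma x / Real.Gamma x

/-- The Euler–Mascheroni constant `γ = −Γ'(1)`. -/
def eulerGamma : ℝ := -(deriv Real.Gamma 1)

/-- The constant `ρ_N = 2 ln 2 + ψ(N/2) − γ`. -/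
def rhoN (N : ℕ) : ℝ := 2 * Real.log 2 + digammaFn ((N : ℝ) / 2) - eulerGamma

/-- A primitive on `[0, ∞)`, vanishing at `0`, of `r ↦ (r² + 1)^{-s/2} r^{s-1}`, whose difference
with `log` tends to `c` at infinity. -/
def HasLogPrimitive (s c : ℝ) : Prop :=
  ∃ F : ℝ → ℝ, F 0 = 0 ∧ Continuous F ∧
    (∀ r, 0 < r → HasDerivAt F ((r ^ 2 + 1) ^ (-s / 2) * r ^ (s - 1)) r) ∧
    Tendsto (fun r => F r - Real.log r) atTop (𝓝 c)

lemma tendsto_sq_div_sq_add_one :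
    Tendsto (fun r : ℝ => r ^ 2 / (r ^ 2 + 1)) atTop (𝓝 1) := by
  have h : Tendsto (fun r : ℝ => r ^ 2 + 1) atTop atTop :=
    tendsto_atTop_add_const_right _ _ (tendsto_pow_atTop two_ne_zero)
  have h' : Tendsto (fun r : ℝ => 1 - (r ^ 2 + 1)⁻¹) atTop (𝓝 (1 - 0)) :=
    tendsto_const_nhds.sub (tendsto_inv_atTop_zero.comp h)
  rw [sub_zero] at h'
  refine h'.congr fun r => ?_
  have : r ^ 2 + 1 ≠ 0 := by positivity
  field_simp
  ring

lemma hasDerivAt_sq_div_sq_add_one_rpow (s : ℝ) {r : ℝ} (hr : 0 < r) :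
    HasDerivAt (fun r : ℝ => (r ^ 2 / (r ^ 2 + 1)) ^ (s / 2))
      (s * ((r ^ 2 + 1) ^ (-s / 2) * r ^ (s - 1) -
        (r ^ 2 + 1) ^ (-(s + 2) / 2) * r ^ (s + 2 - 1))) r := by
  have hpos : 0 < r ^ 2 + 1 := by positivity
  have hsq : HasDerivAt (fun r : ℝ => r ^ 2) (2 * r) r := by
    simpa using hasDerivAt_pow 2 r
  have h := (hsq.div (hsq.add_const 1) hpos.ne').rpow_const (p := s / 2)
    (Or.inl (by simp only [Pi.div_apply]; positivity))
  refine h.congr_deriv ?_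
  have e1 : (r ^ 2) ^ (s / 2 - 1) = r ^ (s - 1) / r := by
    rw [← Real.rpow_natCast, ← Real.rpow_mul hr.le, ← Real.rpow_sub_one hr.ne']
    congr 1
    push_cast
    ring
  have e2 : (r ^ 2 + 1) ^ (s / 2 - 1) = ((r ^ 2 + 1) ^ (-s / 2))⁻¹ / (r ^ 2 + 1) := by
    rw [← Real.rpow_neg hpos.le, ← Real.rpow_sub_one hpos.ne']
    congr 1
    ring
  have e3 : (r ^ 2 + 1) ^ (-(s + 2) / 2) = (r ^ 2 + 1) ^ (-s / 2) / (r ^ 2 + 1) := by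
    rw [← Real.rpow_sub_one hpos.ne']
    congr 1
    ring
  have e4 : r ^ (s + 2 - 1) = r ^ (s - 1) * r ^ 2 := by
    rw [← Real.rpow_natCast r 2, ← Real.rpow_add hr]
    congr 1
    push_cast
    ring
  rw [Pi.div_apply, Real.div_rpow (by positivity) hpos.le, e1, e2, e3, e4]
  have := (Real.rpow_pos_of_pos hpos (-s / 2)).ne'
  field_simp

lemma HasLogPrimitive.add_two {s c : ℝ} (hs : 0 < s) (h : HasLogPrimitive s c) :
    HasLogPrimitive (s + 2) (c - s⁻¹) := by
  obtain ⟨F, h0, hc, hd, hl⟩ := h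
  refine ⟨fun r => F r - s⁻¹ * (r ^ 2 / (r ^ 2 + 1)) ^ (s / 2), ?_, ?_, fun r hr => ?_, ?_⟩
  · simp [h0, Real.zero_rpow (half_pos hs).ne']
  · refine hc.sub (continuous_const.mul (Continuous.rpow_const ?_ fun _ => Or.inr (by positivity)))
    exact (continuous_pow 2).div (by fun_prop) fun r => by positivity
  · refine ((hd r hr).sub
      ((hasDerivAt_sq_div_sq_add_one_rpow s hr).const_mul s⁻¹)).congr_deriv ?_
    field_simp
    ring
  · have := (tendsto_sq_div_sq_add_one.rpow_const (p := s / 2) (Or.inl one_ne_zero)).const_mul s⁻¹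
    rw [Real.one_rpow, mul_one] at this
    refine (hl.sub this).congr fun r => ?_
    ring

lemma hasLogPrimitive_one : HasLogPrimitive 1 (Real.log 2) := by
  refine ⟨Real.arsinh, Real.arsinh_zero, Real.continuous_arsinh, fun r hr => ?_, ?_⟩
  · refine (Real.hasDerivAt_arsinh r).congr_deriv ?_
    rw [Real.sqrt_eq_rpow, ← Real.rpow_neg (by positivity)]
    norm_num [add_comm]
  · have h := (tendsto_sq_div_sq_add_one.inv₀ one_ne_zero).sqrt.const_add 1
    have h2 := (h.log (by norm_num))
    norm_num at h2
    refine h2.congr' ?_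
    filter_upwards [eventually_gt_atTop 0] with r hr
    rw [Real.arsinh, ← Real.log_div (by positivity) hr.ne']
    congr 1
    rw [add_div r, div_self hr.ne', Real.sqrt_div' _ (by positivity), Real.sqrt_sq hr.le,
      add_comm 1 (r ^ 2)]

lemma hasLogPrimitive_two : HasLogPrimitive 2 0 := by
  refine ⟨fun r => 2⁻¹ * Real.log (r ^ 2 + 1), by simp, ?_, fun r hr => ?_, ?_⟩
  · exact continuous_const.mul (Continuous.log (by fun_prop) fun r => by positivity)
  · have hsq : HasDerivAt (fun r : ℝ => r ^ 2 + 1) (2 * r) r := by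
      simpa using (hasDerivAt_pow 2 r).add_const 1
    refine ((hsq.log (by positivity)).const_mul 2⁻¹).congr_deriv ?_
    norm_num [Real.rpow_neg_one]
    field_simp
  · have h := ((tendsto_sq_div_sq_add_one.inv₀ one_ne_zero).log (by norm_num)).const_mul 2⁻¹
    norm_num at h
    refine h.congr' ?_
    filter_upwards [eventually_gt_atTop 0] with r hr
    rw [Real.log_div (by positivity) (by positivity), Real.log_pow]
    push_cast
    ring

lemma HasLogPrimitive.qN_add_qTildeN {N : ℕ} {c : ℝ} (hN : 1 ≤ N) (h : HasLogPrimitive N c) :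
    qN N + qTildeN N = 2 * c := by
  obtain ⟨F, h0, hc, hd, hl⟩ := h
  have hN' : (1 : ℝ) ≤ N := by exact_mod_cast hN
  have htail : ∫ r in Ioi (1 : ℝ),
      ((r ^ 2 + 1) ^ (-(N : ℝ) / 2) - r ^ (-(N : ℝ))) * r ^ ((N : ℝ) - 1) = c - F 1 := by
    have := integral_Ioi_of_hasDerivAt_of_nonpos (a := 1) (l := c)
      (g := fun r => F r - Real.log r)
      (g' := fun r => ((r ^ 2 + 1) ^ (-(N : ℝ) / 2) - r ^ (-(N : ℝ))) * r ^ ((N : ℝ) - 1))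
      (hc.continuousAt.sub (Real.continuousAt_log one_ne_zero)).continuousWithinAt
      (fun r hr => ?_) (fun r hr => ?_) hl
    · simpa using this
    · have hr0 : 0 < r := zero_lt_one.trans hr
      refine ((hd r hr0).sub (Real.hasDerivAt_log hr0.ne')).congr_deriv ?_
      rw [sub_mul, ← Real.rpow_add hr0, ← Real.rpow_neg_one]
      ring_nf
    · have hr0 : 0 < r := zero_lt_one.trans hr
      refine mul_nonpos_of_nonpos_of_nonneg (sub_nonpos.2 ?_) (by positivity)
      have : r ^ (-(N : ℝ)) = (r ^ 2) ^ (-(N : ℝ) / 2) := by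
        rw [← Real.rpow_natCast r 2, ← Real.rpow_mul hr0.le]
        congr 1
        push_cast
        ring
      rw [this]
      exact Real.rpow_le_rpow_of_nonpos (by positivity) (by linarith) (by linarith)
  have hhead : ∫ r in (0 : ℝ)..1, (r ^ 2 + 1) ^ (-(N : ℝ) / 2) * r ^ ((N : ℝ) - 1) = F 1 := by
    rw [intervalIntegral.integral_eq_sub_of_hasDerivAt_of_le zero_le_one hc.continuousOn
      (fun r hr => hd r hr.1), h0, sub_zero]
    refine Continuous.intervalIntegrable (Continuous.mul ?_ ?_) _ _
    · exact Continuous.rpow_const (by fun_prop) fun r => Or.inl (by positivity)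
    · exact Continuous.rpow_const continuous_id fun r => Or.inr (by linarith)
  rw [qN, qTildeN, htail, hhead]
  ring

lemma digammaFn_add_one {x : ℝ} (hx : 0 < x) : digammaFn (x + 1) = digammaFn x + x⁻¹ := by
  have hG : HasDerivAt Real.Gamma (deriv Real.Gamma x) x :=
    (Real.differentiableAt_Gamma fun m => by
      have : (0 : ℝ) ≤ m := m.cast_nonneg
      linarith).hasDerivAt
  have h : HasDerivAt (fun y => Real.Gamma (y + 1))
      (1 * Real.Gamma x + x * deriv Real.Gamma x) x := by
    refine ((hasDerivAt_id x).mul hG).congr_of_eventuallyEq ?_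
    filter_upwards [eventually_ne_nhds hx.ne'] with y hy
    exact Real.Gamma_add_one hy
  have hd : deriv Real.Gamma (x + 1) = 1 * Real.Gamma x + x * deriv Real.Gamma x := by
    rw [← h.deriv, deriv_comp_add_const]
  have := (Real.Gamma_pos_of_pos hx).ne'
  rw [digammaFn, digammaFn, hd, Real.Gamma_add_one hx.ne']
  field_simp
  ring

lemma eulerGamma_eq : eulerGamma = Real.eulerMascheroniConstant := by
  rw [eulerGamma, Real.hasDerivAt_Gamma_one.deriv, neg_neg]

lemma digammaFn_one : digammaFn 1 = -eulerGamma := by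
  simp [digammaFn, eulerGamma]

lemma digammaFn_one_half : digammaFn (1 / 2) = -eulerGamma - 2 * Real.log 2 := by
  have : √π ≠ 0 := by positivity
  rw [digammaFn, Real.hasDerivAt_Gamma_one_half.deriv, Real.Gamma_one_half_eq, eulerGamma_eq]
  field_simp
  ring

lemma hasLogPrimitive_natCast_add_one (n : ℕ) :
    HasLogPrimitive (n + 1 : ℕ) ((-eulerGamma - digammaFn ((n + 1 : ℕ) / 2)) / 2) := by
  induction n using Nat.twoStepInduction with
  | zero =>
    convert hasLogPrimitive_one using 1
    · simp
    · norm_num only [zero_add, Nat.cast_one]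
      rw [digammaFn_one_half]
      ring
  | one =>
    convert hasLogPrimitive_two using 1
    · norm_num
    · norm_num [digammaFn_one]
  | more n ih _ =>
    have hpos : (0 : ℝ) < (n + 1 : ℕ) := by positivity
    convert ih.add_two hpos using 1
    · push_cast
      ring
    · have : ((n + 2 + 1 : ℕ) : ℝ) / 2 = ((n + 1 : ℕ) : ℝ) / 2 + 1 := by
        push_cast
        ring
      rw [this, digammaFn_add_one (by positivity)]
      field_simp
      ring

/-- `q_N + q̃_N + ρ_N = 2(ln 2 − γ)`, equivalently
`q_N + q̃_N = −γ − ψ(N/2)`. -/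
theorem stmt17 (N : ℕ) (hN : 1 ≤ N) :
    qN N + qTildeN N + rhoN N = 2 * (Real.log 2 - eulerGamma) ∧
    qN N + qTildeN N = -eulerGamma - digammaFn ((N : ℝ) / 2) := by
  have h : qN N + qTildeN N = -eulerGamma - digammaFn ((N : ℝ) / 2) := by
    obtain ⟨n, rfl⟩ := Nat.exists_eq_add_of_le' hN
    rw [(hasLogPrimitive_natCast_add_one n).qN_add_qTildeN hN]
    ring
  refine ⟨?_, h⟩
  rw [h, rhoN]
  ring
end
end

section
/- Let N ≥ 1 be an integer, let 0 < s < 1/2, and let u ∈ C_c²(ℝ^N). Define the (even-in-t) Caffarelli–Silvestre extension w_s(x,t) = p_{N,s} |t|^{2s} ∫_{ℝ^N} u(x̃) (|x−x̃|² + t²)^{−(N+2s)/2} dx̃ with p_{N,s} = Γ(N/2 + s)/(π^{N/2} Γ(s)), the fractional Laplacian (−Δ)^s u(x) = c_{N,s} lim_{ε→0⁺} ∫_{ℝ^N ∖ B_ε(x)} (u(x) − u(y)) |x−y|^{−N−2s} dy with c_{N,s} = 2^{2s} π^{−N/2} s Γ((N+2s)/2)/Γ(1−s), and d_s = 2^{2s−1}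 Γ(s)/Γ(1−s). Then for every φ ∈ C_c^∞(ℝ^{N+1}), ∫_{ℝ^{N+1}} w_s(x,t) · div(|t|^{1−2s} ∇φ(x,t)) dx dt = −(2/d_s) ∫_{ℝ^N} (−Δ)^s u(x) · φ(x,0) dx; that is, −div(|t|^{1−2s} ∇w_s) = (2/d_s) [(−Δ)^s u] ℒ^N ⊗ δ_0 in ℝ^{N+1} in the distributional sense. -/
open MeasureTheory Real Filter Topology Set Metric

noncomputable section

/-- The Poisson constant `p_{N,s} = Γ(N/2+s)/(π^{N/2} Γ(s))`. -/
def pNs (N : ℕ) (s : ℝ) : ℝ :=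
  Real.Gamma ((N : ℝ) / 2 + s) / (Real.pi ^ ((N : ℝ) / 2) * Real.Gamma s)

/-- The fractional Laplacian normalization constant
`c_{N,s} = 2^{2s} π^{−N/2} s Γ((N+2s)/2)/Γ(1−s)`. -/
def cNs (N : ℕ) (s : ℝ) : ℝ :=
  (2 : ℝ) ^ (2 * s) * Real.pi ^ (-(N : ℝ) / 2) * s *
    Real.Gamma (((N : ℝ) + 2 * s) / 2) / Real.Gamma (1 - s)

/-- The Caffarelli–Silvestre constant `d_s = 2^{2s−1} Γ(s)/Γ(1−s)`. -/
def dCS (s : ℝ) : ℝ := (2 : ℝ) ^ (2 * s - 1) * Real.Gamma s / Real.Gamma (1 - s)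

/-- The (even-in-`t`) Caffarelli–Silvestre extension
`w_s(x,t) = p_{N,s} |t|^{2s} ∫ u(x̃)(|x−x̃|²+t²)^{−(N+2s)/2} dx̃`. -/
def csExt (N : ℕ) (s : ℝ) (u : EuclideanSpace ℝ (Fin N) → ℝ)
    (x : EuclideanSpace ℝ (Fin N)) (t : ℝ) : ℝ :=
  pNs N s * |t| ^ (2 * s) *
    ∫ y, u y * (‖x - y‖ ^ 2 + t ^ 2) ^ (-((N : ℝ) + 2 * s) / 2)

/-- Truncated negative powers of the norm are integrable below the critical exponent. -/
theorem integrable_truncated_norm_rpow {F : Type*} [NormedAddCommGroup F] [NormedSpace ℝ F]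
    [MeasurableSpace F] [BorelSpace F] [FiniteDimensional ℝ F] [Nontrivial F]
    (μ : Measure F) [μ.IsAddHaarMeasure] {q : ℝ} (hq : q < Module.finrank ℝ F) (R : ℝ) :
    Integrable (fun x : F => (Set.Iic R).indicator (fun r : ℝ => r ^ (-q)) ‖x‖) μ := by
  rw [integrable_fun_norm_addHaar μ (f := (Set.Iic R).indicator (fun r : ℝ => r ^ (-q)))]
  have hd : 0 < Module.finrank ℝ F := Module.finrank_pos
  have h1 : IntegrableOn (fun r : ℝ => r ^ ((Module.finrank ℝ F : ℝ) - 1 - q))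
      (Set.Ioo 0 (max R 0 + 1)) := by
    rw [intervalIntegral.integrableOn_Ioo_rpow_iff (by positivity)]
    linarith
  have h2 : Integrable ((Set.Ioc 0 R).indicator
      (fun r : ℝ => r ^ ((Module.finrank ℝ F : ℝ) - 1 - q))) := by
    rw [integrable_indicator_iff measurableSet_Ioc]
    refine h1.mono_set fun r hr => ⟨hr.1, ?_⟩
    have := le_max_left R 0
    linarith [hr.2]
  refine (h2.integrableOn (s := Set.Ioi 0)).congr_fun ?_ measurableSet_Ioi
  intro r (hr : 0 < r)
  by_cases h : r ≤ R
  · rw [Set.indicator_of_mem (show r ∈ Set.Ioc 0 R from ⟨hr, h⟩)]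
    simp only [Set.indicator_of_mem (show r ∈ Set.Iic R from h), smul_eq_mul]
    rw [← Real.rpow_natCast, ← Real.rpow_add hr, Nat.cast_sub (by omega)]
    push_cast; ring_nf
  · rw [Set.indicator_of_notMem (fun h' => h h'.2)]
    simp [Set.indicator_of_notMem (show r ∉ Set.Iic R from h)]

/-- The kernel `‖x‖ ^ (-q)` is integrable against functions vanishing to first order at `0`
and bounded at infinity, when `d < q < d + 1`. -/
theorem integrable_min_mul_norm_rpow {F : Type*} [NormedAddCommGroup F] [NormedSpace ℝ F]
    [MeasurableSpace F] [BorelSpace F] [FiniteDimensional ℝ F] [Nontrivial F]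
    (μ : Measure F) [μ.IsAddHaarMeasure] {q : ℝ} (hq : Module.finrank ℝ F < q)
    (hq' : q < Module.finrank ℝ F + 1) :
    Integrable (fun x : F => min 1 ‖x‖ * ‖x‖ ^ (-q)) μ := by
  rw [integrable_fun_norm_addHaar μ (f := fun r : ℝ => min 1 r * r ^ (-q))]
  have hd : 0 < Module.finrank ℝ F := Module.finrank_pos
  have e : ∀ r : ℝ, 0 < r → r ^ (Module.finrank ℝ F - 1) * r ^ (-q)
      = r ^ ((Module.finrank ℝ F : ℝ) - 1 - q) := fun r hr => by
    rw [← Real.rpow_natCast, ← Real.rpow_add hr, Nat.cast_sub (by omega)]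
    push_cast; ring_nf
  rw [show Set.Ioi (0 : ℝ) = Set.Ioo 0 2 ∪ Set.Ioi 1 by
    ext r; simp only [mem_Ioi, mem_union, mem_Ioo]; constructor
    · intro h; by_cases h2 : r < 2
      · exact Or.inl ⟨h, h2⟩
      · right; linarith
    · rintro (h | h) <;> linarith]
  have hm : Measurable fun r : ℝ => r ^ (Module.finrank ℝ F - 1) • (min 1 r * r ^ (-q)) := by
    fun_prop
  refine IntegrableOn.union ?_ ?_
  · have h1 : IntegrableOn (fun r : ℝ => r ^ ((Module.finrank ℝ F : ℝ) - q)) (Set.Ioo 0 2) := by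
      rw [intervalIntegral.integrableOn_Ioo_rpow_iff (by positivity)]
      linarith
    refine Integrable.mono' h1 hm.aestronglyMeasurable ?_
    refine (ae_restrict_iff' measurableSet_Ioo).2 (.of_forall fun r hr => ?_)
    have h0 : 0 < r := hr.1
    have : r ^ ((Module.finrank ℝ F : ℝ) - q)
        = r * (r ^ (Module.finrank ℝ F - 1) * r ^ (-q)) := by
      rw [e r h0]
      nth_rewrite 2 [← Real.rpow_one r]
      rw [← Real.rpow_add h0]
      congr 1; ring
    rw [this, Real.norm_of_nonneg (by rw [smul_eq_mul]; positivity), smul_eq_mul]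
    have : min 1 r ≤ r := min_le_right _ _
    calc r ^ (Module.finrank ℝ F - 1) * (min 1 r * r ^ (-q))
        ≤ r ^ (Module.finrank ℝ F - 1) * (r * r ^ (-q)) := by gcongr
      _ = _ := by ring
  · have h1 : IntegrableOn (fun r : ℝ => r ^ ((Module.finrank ℝ F : ℝ) - 1 - q)) (Set.Ioi 1) :=
      integrableOn_Ioi_rpow_of_lt (by linarith) one_pos
    refine Integrable.mono' h1 hm.aestronglyMeasurable ?_
    refine (ae_restrict_iff' measurableSet_Ioi).2 (.of_forall fun r (hr : 1 < r) => ?_)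
    have h0 : 0 < r := by linarith
    rw [← e r h0, Real.norm_of_nonneg (by rw [smul_eq_mul]; positivity), smul_eq_mul]
    have : min 1 r ≤ 1 := min_le_left _ _
    calc r ^ (Module.finrank ℝ F - 1) * (min 1 r * r ^ (-q))
        ≤ r ^ (Module.finrank ℝ F - 1) * (1 * r ^ (-q)) := by gcongr
      _ = _ := by ring

/-- The integral over a space slice of the conormal derivative of the fundamental solution
vanishes. -/
theorem integral_conormal_eq_zero {F : Type*} [NormedAddCommGroup F] [NormedSpace ℝ F]
    [MeasurableSpace F] [BorelSpace F] [FiniteDimensional ℝ F] [Nontrivial F]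
    (μ : Measure F) [μ.IsAddHaarMeasure] {s m t : ℝ} (hs : 0 < s)
    (hm : 2 * m = Module.finrank ℝ F + 2 * s) (ht : 0 < t) :
    Integrable (fun x : F => 2 * s * (‖x‖ ^ 2 + t ^ 2) ^ (-m)
      - 2 * m * t ^ 2 * (‖x‖ ^ 2 + t ^ 2) ^ (-m - 1)) μ ∧
    ∫ x : F, (2 * s * (‖x‖ ^ 2 + t ^ 2) ^ (-m)
      - 2 * m * t ^ 2 * (‖x‖ ^ 2 + t ^ 2) ^ (-m - 1)) ∂μ = 0 := by
  have hd : 0 < Module.finrank ℝ F := Module.finrank_pos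
  set n := Module.finrank ℝ F with hn
  have hm0 : 0 < m := by have : (0 : ℝ) < n := by exact_mod_cast hd
                         linarith
  let f : ℝ → ℝ := fun r => 2 * s * (r ^ 2 + t ^ 2) ^ (-m)
      - 2 * m * t ^ 2 * (r ^ 2 + t ^ 2) ^ (-m - 1)
  let g : ℝ → ℝ := fun r => -(r ^ n * (r ^ 2 + t ^ 2) ^ (-m))
  have hpos : ∀ r : ℝ, 0 < r ^ 2 + t ^ 2 := fun r => by positivity
  have hg : ∀ r : ℝ, HasDerivAt g (r ^ (n - 1) * f r) r := by
    intro r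
    have h1 : HasDerivAt (fun r : ℝ => r ^ 2 + t ^ 2) (2 * r) r := by
      simpa using (hasDerivAt_pow 2 r).add_const (t ^ 2)
    have h2 := h1.rpow_const (p := -m) (Or.inl (hpos r).ne')
    have h3 := ((hasDerivAt_pow n r).mul h2).neg
    refine h3.congr_deriv ?_
    have e1 : (r ^ 2 + t ^ 2) ^ (-m) = (r ^ 2 + t ^ 2) * (r ^ 2 + t ^ 2) ^ (-m - 1) := by
      nth_rewrite 2 [← Real.rpow_one (r ^ 2 + t ^ 2)]
      rw [← Real.rpow_add (hpos r)]; congr 1; ring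
    obtain ⟨k, hk⟩ : ∃ k, n = k + 1 := ⟨n - 1, by omega⟩
    have hs' : 2 * s = 2 * m - n := by linarith
    simp only [f, hs', e1]
    rw [hk]
    simp only [Nat.add_sub_cancel]
    push_cast
    ring
  have hcf : Continuous f := by
    have h1 : Continuous fun r : ℝ => r ^ 2 + t ^ 2 := by fun_prop
    exact (continuous_const.mul (h1.rpow_const fun r => Or.inl (hpos r).ne')).sub
      (continuous_const.mul (h1.rpow_const fun r => Or.inl (hpos r).ne'))
  have hbound : ∀ r : ℝ, 0 < r → (r ^ 2 + t ^ 2) ^ (-m) ≤ r ^ (-(2 * m)) := by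
    intro r hr
    rw [show -(2 * m) = (2 : ℕ) * (-m) by push_cast; ring, Real.rpow_mul hr.le, Real.rpow_natCast]
    exact Real.rpow_le_rpow_of_nonpos (by positivity) (by nlinarith [sq_nonneg t]) (by linarith)
  have hfb : ∀ r : ℝ, |f r| ≤ (2 * s + 2 * m) * (r ^ 2 + t ^ 2) ^ (-m) := by
    intro r
    have e1 : (r ^ 2 + t ^ 2) ^ (-m) = (r ^ 2 + t ^ 2) * (r ^ 2 + t ^ 2) ^ (-m - 1) := by
      nth_rewrite 2 [← Real.rpow_one (r ^ 2 + t ^ 2)]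
      rw [← Real.rpow_add (hpos r)]; congr 1; ring
    have hb : 0 < (r ^ 2 + t ^ 2) ^ (-m - 1) := Real.rpow_pos_of_pos (hpos r) _
    simp only [f, e1]
    have h1 : 0 ≤ s * ((r ^ 2 + t ^ 2) * (r ^ 2 + t ^ 2) ^ (-m - 1)) := by positivity
    have h2 : 0 ≤ m * (r ^ 2 * (r ^ 2 + t ^ 2) ^ (-m - 1)) := by positivity
    have h3 : 0 ≤ m * (t ^ 2 * (r ^ 2 + t ^ 2) ^ (-m - 1)) := by positivity
    rw [abs_le]; constructor <;> nlinarith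
  have hint : IntegrableOn (fun r => r ^ (n - 1) * f r) (Set.Ioi 0) := by
    rw [← Set.Ioc_union_Ioi_eq_Ioi (zero_le_one (α := ℝ))]
    refine IntegrableOn.union ?_ ?_
    · exact (((continuous_pow _).mul hcf).integrableOn_Icc (a := 0) (b := 1)).mono_set
        Set.Ioc_subset_Icc_self
    · have h1 : IntegrableOn (fun r : ℝ => (2 * s + 2 * m) * r ^ (-1 - 2 * s)) (Set.Ioi 1) :=
        (integrableOn_Ioi_rpow_of_lt (by linarith) one_pos).const_mul _
      refine Integrable.mono' h1 ((continuous_pow _).mul hcf).aestronglyMeasurable ?_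
      refine (ae_restrict_iff' measurableSet_Ioi).2 (.of_forall fun r (hr : 1 < r) => ?_)
      have h0 : 0 < r := by linarith
      rw [norm_mul, Real.norm_of_nonneg (by positivity), Real.norm_eq_abs]
      have : r ^ (-1 - 2 * s) = r ^ (n - 1) * r ^ (-(2 * m)) := by
        rw [← Real.rpow_natCast, ← Real.rpow_add h0, Nat.cast_sub (by omega)]
        congr 1; push_cast; linarith
      rw [this]
      calc r ^ (n - 1) * |f r| ≤ r ^ (n - 1) * ((2 * s + 2 * m) * r ^ (-(2 * m))) := by
            gcongr
            exact (hfb r).trans (by gcongr; exact hbound r h0)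
        _ = _ := by ring
  refine ⟨(integrable_fun_norm_addHaar μ (f := f)).2 hint, ?_⟩
  have hlim : Tendsto g atTop (𝓝 0) := by
    have h1 : Tendsto (fun r : ℝ => r ^ (-(2 * s))) atTop (𝓝 0) :=
      tendsto_rpow_neg_atTop (by linarith)
    refine squeeze_zero_norm' ?_ h1
    filter_upwards [eventually_gt_atTop 0] with r hr
    have : r ^ (-(2 * s)) = r ^ n * r ^ (-(2 * m)) := by
      rw [← Real.rpow_natCast, ← Real.rpow_add hr]
      congr 1; linarith
    rw [this]
    simp only [g, norm_neg]
    rw [Real.norm_of_nonneg (by have := hpos r; positivity)]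
    gcongr
    exact hbound r hr
  have := integral_Ioi_of_hasDerivAt_of_tendsto' (a := 0) (fun r _ => hg r) hint hlim
  have hz : g 0 = 0 := by simp [g, show n ≠ 0 by omega]
  have key := integral_fun_norm_addHaar μ f
  rw [show (∫ y in Set.Ioi (0 : ℝ), y ^ (Module.finrank ℝ F - 1) • f y) = 0 by
    simpa [hz] using this] at key
  simpa using key

/-- The derivative of `f` in the direction `v`. -/
def dirDeriv {F : Type*} [NormedAddCommGroup F] [NormedSpace ℝ F] (v : F) (f : F → ℝ) : F → ℝ :=
  fun p => fderiv ℝ f p v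

section DirDeriv

variable {F : Type*} [NormedAddCommGroup F] [NormedSpace ℝ F]

theorem ContDiff.dirDeriv {f : F → ℝ} (hf : ContDiff ℝ (⊤ : ℕ∞) f) (v : F) :
    ContDiff ℝ (⊤ : ℕ∞) (dirDeriv v f) := by
  unfold _root_.dirDeriv
  exact (hf.fderiv_right (m := ((⊤ : ℕ∞) : WithTop ℕ∞)) (by simp)).clm_apply contDiff_const

theorem dirDeriv_eq_zero {f : F → ℝ} {R : ℝ} (hf : ∀ p, R < ‖p‖ → f p = 0) (v : F) (p : F)
    (hp : R < ‖p‖) : dirDeriv v f p = 0 := by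
  have : f =ᶠ[𝓝 p] fun _ => 0 := by
    filter_upwards [(isOpen_lt continuous_const continuous_norm).mem_nhds hp] with q hq
    exact hf q hq
  rw [dirDeriv, this.fderiv_eq]
  simp

theorem hasDerivAt_line {f : F → ℝ} (hf : ContDiff ℝ (⊤ : ℕ∞) f) (v p : F) (t : ℝ) :
    HasDerivAt (fun σ : ℝ => f (p + σ • v)) (dirDeriv v f (p + t • v)) t := by
  have h1 : HasDerivAt (fun σ : ℝ => p + σ • v) v t := by
    simpa using ((hasDerivAt_id t).smul_const v).const_add p
  exact ((hf.differentiable (by simp)) _).hasFDerivAt.comp_hasDerivAt t h1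

theorem iteratedDeriv_two_line {f : F → ℝ} (hf : ContDiff ℝ (⊤ : ℕ∞) f) (v p : F) :
    iteratedDeriv 2 (fun σ : ℝ => f (p + σ • v)) 0 = dirDeriv v (dirDeriv v f) p := by
  have h1 : deriv (fun σ : ℝ => f (p + σ • v)) = fun σ => dirDeriv v f (p + σ • v) :=
    funext fun t => (hasDerivAt_line hf v p t).deriv
  rw [iteratedDeriv_succ, iteratedDeriv_one, h1, (hasDerivAt_line (hf.dirDeriv v) v p 0).deriv]
  simp

theorem dirDeriv_comp_add_right (f : F → ℝ) (v a : F) :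
    dirDeriv v (fun p => f (p + a)) = fun p => dirDeriv v f (p + a) := by
  funext p
  simp only [dirDeriv, fderiv_comp_add_right]

theorem hasDerivAt_snd {G : Type*} [NormedAddCommGroup G] [NormedSpace ℝ G] {f : G × ℝ → ℝ}
    (hf : ContDiff ℝ (⊤ : ℕ∞) f) (z : G) (t : ℝ) :
    HasDerivAt (fun τ : ℝ => f (z, τ)) (dirDeriv (0, 1) f (z, t)) t := by
  simpa using hasDerivAt_line hf ((0 : G), (1 : ℝ)) (z, 0) t

theorem integral_eq_zero_of_hasLineDerivAt [MeasurableSpace F] [BorelSpace F]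
    [FiniteDimensional ℝ F] {μ : Measure F} [μ.IsAddHaarMeasure] {g g' : F → ℝ} {v : F}
    (hg : Integrable g μ) (hg' : Integrable g' μ) (h : ∀ x, HasLineDerivAt ℝ g (g' x) x v) :
    ∫ x, g' x ∂μ = 0 := by
  have := integral_bilinear_hasLineDerivAt_right_eq_neg_left_of_integrable (μ := μ)
    (f := fun _ => (1 : ℝ)) (f' := fun _ => 0) (g := g) (g' := g') (v := v)
    (B := ContinuousLinearMap.mul ℝ ℝ) (by simp) (by simpa using hg') (by simpa using hg)
    (fun x _ => by simpa [HasLineDerivAt] using hasDerivAt_const (0 : ℝ) (1 : ℝ)) (fun x _ => h x)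
  simpa using this

end DirDeriv

/-- The kernel `(|z|² + t²)^(-m)`. -/
def csKernel (N : ℕ) (m : ℝ) (p : EuclideanSpace ℝ (Fin N) × ℝ) : ℝ :=
  (‖p.1‖ ^ 2 + p.2 ^ 2) ^ (-m)

/-- The sum of second derivatives of `φ` in the first factor. -/
def spaceLaplacian (N : ℕ) (φ : EuclideanSpace ℝ (Fin N) × ℝ → ℝ) :
    EuclideanSpace ℝ (Fin N) × ℝ → ℝ :=
  fun p => ∑ i : Fin N, dirDeriv (EuclideanSpace.single i (1 : ℝ), 0)
    (dirDeriv (EuclideanSpace.single i (1 : ℝ), 0) φ) p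

/-- On `t > 0` this is `t^(2s) div(t^(1-2s) ∇φ)`. -/
def weightedDiv (N : ℕ) (s : ℝ) (φ : EuclideanSpace ℝ (Fin N) × ℝ → ℝ) :
    EuclideanSpace ℝ (Fin N) × ℝ → ℝ :=
  fun p => p.2 * (spaceLaplacian N φ p + dirDeriv (0, 1) (dirDeriv (0, 1) φ) p)
    + (1 - 2 * s) * dirDeriv (0, 1) φ p

section Kernel

variable {N : ℕ} {s m : ℝ}

theorem csKernel_nonneg (p : EuclideanSpace ℝ (Fin N) × ℝ) : 0 ≤ csKernel N m p :=
  Real.rpow_nonneg (by positivity) _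

theorem csKernel_le_norm (hm : 0 < m) (p : EuclideanSpace ℝ (Fin N) × ℝ) :
    csKernel N m p ≤ ‖p‖ ^ (-(2 * m)) := by
  rw [show -(2 * m) = (2 : ℕ) * (-m) by push_cast; ring, Real.rpow_mul (norm_nonneg _),
    Real.rpow_natCast, csKernel]
  by_cases hp : p = 0
  · simp [hp]
  refine Real.rpow_le_rpow_of_nonpos (pow_pos (norm_pos_iff.2 hp) 2) ?_ (by linarith)
  have h1 := sq_nonneg ‖p.1‖
  have h2 := sq_nonneg p.2
  rcases max_choice ‖p.1‖ ‖p.2‖ with h | h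
  · rw [Prod.norm_def, h]; linarith
  · rw [Prod.norm_def, h, Real.norm_eq_abs, sq_abs]; linarith

theorem csKernel_le_space (hm : 0 < m) {z : EuclideanSpace ℝ (Fin N)} (hz : z ≠ 0) (t : ℝ) :
    csKernel N m (z, t) ≤ ‖z‖ ^ (-(2 * m)) := by
  rw [show -(2 * m) = (2 : ℕ) * (-m) by push_cast; ring, Real.rpow_mul (norm_nonneg _),
    Real.rpow_natCast, csKernel]
  exact Real.rpow_le_rpow_of_nonpos (pow_pos (norm_pos_iff.2 hz) 2)
    (by nlinarith [sq_nonneg t]) (by linarith)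

theorem mul_csKernel_le (hm : 1 / 2 < m) {z : EuclideanSpace ℝ (Fin N)} (hz : z ≠ 0) {t : ℝ}
    (ht : 0 < t) (ht1 : t ≤ 1) :
    t * csKernel N m (z, t) ≤ min 1 ‖z‖ * ‖z‖ ^ (-(2 * m)) := by
  have hz0 : 0 < ‖z‖ := norm_pos_iff.2 hz
  have hK := csKernel_le_space (m := m) (by linarith) hz t
  rw [min_mul_of_nonneg _ _ (Real.rpow_nonneg hz0.le _)]
  refine le_min ?_ ?_
  · exact mul_le_mul ht1 hK (csKernel_nonneg _) zero_le_one
  · have hr : 0 < ‖z‖ ^ 2 + t ^ 2 := by positivity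
    have h1 : t ≤ (‖z‖ ^ 2 + t ^ 2) ^ (1 / 2 : ℝ) := by
      rw [← Real.sqrt_eq_rpow]
      exact Real.le_sqrt_of_sq_le (by nlinarith)
    have h2 : ‖z‖ * ‖z‖ ^ (-(2 * m)) = (‖z‖ ^ 2) ^ (1 / 2 - m) := by
      rw [← Real.rpow_natCast, ← Real.rpow_mul hz0.le]
      nth_rewrite 1 [← Real.rpow_one ‖z‖]
      rw [← Real.rpow_add hz0]; congr 1; push_cast; ring
    rw [h2]
    calc t * csKernel N m (z, t)
        ≤ (‖z‖ ^ 2 + t ^ 2) ^ (1 / 2 : ℝ) * (‖z‖ ^ 2 + t ^ 2) ^ (-m) := by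
          gcongr
          · exact csKernel_nonneg _
          · exact le_rfl
      _ = (‖z‖ ^ 2 + t ^ 2) ^ (1 / 2 - m) := by
          rw [← Real.rpow_add hr]; congr 1
      _ ≤ _ := Real.rpow_le_rpow_of_nonpos (by positivity) (by nlinarith) (by linarith)

theorem measurable_csKernel : Measurable (csKernel N m) := by
  unfold csKernel
  fun_prop

theorem spaceLaplacian_contDiff {φ : EuclideanSpace ℝ (Fin N) × ℝ → ℝ}
    (hφ : ContDiff ℝ (⊤ : ℕ∞) φ) : ContDiff ℝ (⊤ : ℕ∞) (spaceLaplacian N φ) := by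
  unfold spaceLaplacian
  exact ContDiff.sum fun i _ => (hφ.dirDeriv _).dirDeriv _

theorem weightedDiv_continuous {φ : EuclideanSpace ℝ (Fin N) × ℝ → ℝ}
    (hφ : ContDiff ℝ (⊤ : ℕ∞) φ) : Continuous (weightedDiv N s φ) := by
  have h1 := (spaceLaplacian_contDiff hφ).continuous
  have h2 := ((hφ.dirDeriv (0, 1)).dirDeriv (0, 1)).continuous
  have h3 := (hφ.dirDeriv (0, 1)).continuous
  unfold weightedDiv
  fun_prop

theorem spaceLaplacian_eq_zero {φ : EuclideanSpace ℝ (Fin N) × ℝ → ℝ} {R : ℝ}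
    (hR : ∀ p, R < ‖p‖ → φ p = 0) (p : EuclideanSpace ℝ (Fin N) × ℝ) (hp : R < ‖p‖) :
    spaceLaplacian N φ p = 0 :=
  Finset.sum_eq_zero fun _ _ => dirDeriv_eq_zero (dirDeriv_eq_zero hR _) _ p hp

theorem weightedDiv_eq_zero {φ : EuclideanSpace ℝ (Fin N) × ℝ → ℝ} {R : ℝ}
    (hR : ∀ p, R < ‖p‖ → φ p = 0) (p : EuclideanSpace ℝ (Fin N) × ℝ) (hp : R < ‖p‖) :
    weightedDiv N s φ p = 0 := by
  rw [weightedDiv, spaceLaplacian_eq_zero hR p hp, dirDeriv_eq_zero (dirDeriv_eq_zero hR _) _ p hp,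
    dirDeriv_eq_zero hR _ p hp]
  simp

theorem exists_bound_of_zero_outside {F : Type*} [NormedAddCommGroup F] [ProperSpace F]
    {f : F → ℝ} (hf : Continuous f) {R : ℝ} (hR : ∀ p, R < ‖p‖ → f p = 0) :
    ∃ C, 0 ≤ C ∧ ∀ p, |f p| ≤ C := by
  have hc : HasCompactSupport f := HasCompactSupport.intro (isCompact_closedBall 0 R)
    fun p hp => hR p (by simpa using hp)
  obtain ⟨C, hC⟩ := hf.bounded_above_of_compact_support hc
  exact ⟨max C 0, le_max_right _ _, fun p => (hC p).trans (le_max_left _ _)⟩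

theorem csKernel_mul_le (hm : 0 < m) {f : EuclideanSpace ℝ (Fin N) × ℝ → ℝ} {C R : ℝ}
    (hC0 : 0 ≤ C) (hC : ∀ p, |f p| ≤ C) (hR : ∀ p, R < ‖p‖ → f p = 0)
    (p q : EuclideanSpace ℝ (Fin N) × ℝ) {R' : ℝ} (hpq : ‖q‖ ≤ R → ‖p‖ ≤ R') :
    ‖csKernel N m p * f q‖
      ≤ C * (Set.Iic R').indicator (fun r : ℝ => r ^ (-(2 * m))) ‖p‖ := by
  rw [norm_mul, Real.norm_of_nonneg (csKernel_nonneg _), Real.norm_eq_abs]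
  have h0 : 0 ≤ (Set.Iic R').indicator (fun r : ℝ => r ^ (-(2 * m))) ‖p‖ :=
    Set.indicator_apply_nonneg fun _ => Real.rpow_nonneg (norm_nonneg _) _
  by_cases h : R < ‖q‖
  · rw [hR q h]; simp only [abs_zero, mul_zero]; positivity
  · rw [Set.indicator_of_mem (show ‖p‖ ∈ Set.Iic R' from hpq (not_lt.1 h)), mul_comm]
    exact mul_le_mul (hC q) (csKernel_le_norm hm p) (csKernel_nonneg _) hC0

theorem integrable_truncated_norm (hm : 2 * m < N + 1) (R : ℝ) :
    Integrable (fun p : EuclideanSpace ℝ (Fin N) × ℝ =>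
      (Set.Iic R).indicator (fun r : ℝ => r ^ (-(2 * m))) ‖p‖) :=
  integrable_truncated_norm_rpow (volume.prod volume) (by simpa using hm) R

theorem integrable_csKernel_mul (hm0 : 0 < m) (hm : 2 * m < N + 1)
    {f : EuclideanSpace ℝ (Fin N) × ℝ → ℝ} (hf : Continuous f) {R : ℝ}
    (hR : ∀ p, R < ‖p‖ → f p = 0) : Integrable (fun p => csKernel N m p * f p) := by
  obtain ⟨C, hC0, hC⟩ := exists_bound_of_zero_outside hf hR
  refine ((integrable_truncated_norm hm R).const_mul C).mono'
    (measurable_csKernel.mul hf.measurable).aestronglyMeasurable (.of_forall fun p => ?_)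
  exact csKernel_mul_le hm0 hC0 hC hR p p id

end Kernel

section HalfSpace

variable {N : ℕ} {s m : ℝ}

theorem hasDerivAt_rpow_quadratic_time (a z : ℝ) {t : ℝ} (ht : 0 < t) :
    HasDerivAt (fun τ : ℝ => (z ^ 2 + τ ^ 2) ^ a) (2 * a * t * (z ^ 2 + t ^ 2) ^ (a - 1)) t := by
  have h1 : HasDerivAt (fun τ : ℝ => z ^ 2 + τ ^ 2) (2 * t) t := by
    simpa using (hasDerivAt_pow 2 t).const_add (z ^ 2)
  exact (h1.rpow_const (p := a) (Or.inl (by positivity))).congr_deriv (by ring)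

theorem hasDerivAt_rpow_quadratic_space (a : ℝ) (z : EuclideanSpace ℝ (Fin N)) (i : Fin N) {t : ℝ}
    (ht : 0 < t) :
    HasDerivAt (fun σ : ℝ => (‖z + σ • EuclideanSpace.single i (1 : ℝ)‖ ^ 2 + t ^ 2) ^ a)
      (2 * a * z i * (‖z‖ ^ 2 + t ^ 2) ^ (a - 1)) 0 := by
  have h0 : HasDerivAt (fun σ : ℝ => z + σ • EuclideanSpace.single i (1 : ℝ))
      (EuclideanSpace.single i (1 : ℝ)) 0 := by
    simpa using ((hasDerivAt_id (0 : ℝ)).smul_const (EuclideanSpace.single i (1 : ℝ))).const_add z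
  have h1 := h0.norm_sq.add_const (t ^ 2)
  refine (h1.rpow_const (p := a) (Or.inl (by positivity))).congr_deriv ?_
  simp only [EuclideanSpace.inner_single_right, zero_smul, add_zero, conj_trivial]
  ring

theorem hasDerivAt_coord (z : EuclideanSpace ℝ (Fin N)) (i : Fin N) :
    HasDerivAt (fun σ : ℝ => (z + σ • EuclideanSpace.single i (1 : ℝ)) i) 1 0 := by
  have : (fun σ : ℝ => (z + σ • EuclideanSpace.single i (1 : ℝ)) i) = fun σ => z i + σ := by
    funext σ; simp
  rw [this]
  simpa using (hasDerivAt_id (0 : ℝ)).const_add (z i)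

theorem continuous_rpow_quadratic (a : ℝ) {t : ℝ} (ht : 0 < t) :
    Continuous fun z : EuclideanSpace ℝ (Fin N) => (‖z‖ ^ 2 + t ^ 2) ^ a := by
  have h1 : Continuous fun z : EuclideanSpace ℝ (Fin N) => ‖z‖ ^ 2 + t ^ 2 := by fun_prop
  exact h1.rpow_const fun z => Or.inl (by positivity)

/-- The Laplacian in `z` of `(|z|² + t²)^(-m)`. -/
def csKernelLaplacian (N : ℕ) (m : ℝ) (p : EuclideanSpace ℝ (Fin N) × ℝ) : ℝ :=
  -2 * m * N * (‖p.1‖ ^ 2 + p.2 ^ 2) ^ (-m - 1)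
    + 4 * m * (m + 1) * ‖p.1‖ ^ 2 * (‖p.1‖ ^ 2 + p.2 ^ 2) ^ (-m - 2)

theorem continuousOn_rpow_quadratic (a : ℝ) {ε : ℝ} (hε : 0 < ε) :
    ContinuousOn (fun p : EuclideanSpace ℝ (Fin N) × ℝ => (‖p.1‖ ^ 2 + p.2 ^ 2) ^ a)
      (Set.univ ×ˢ Set.Ici ε) := by
  have h1 : Continuous fun p : EuclideanSpace ℝ (Fin N) × ℝ => ‖p.1‖ ^ 2 + p.2 ^ 2 := by fun_prop
  refine h1.continuousOn.rpow_const fun p hp => Or.inl ?_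
  have : 0 < p.2 := lt_of_lt_of_le hε hp.2
  positivity

theorem integrableOn_halfSpace {f : EuclideanSpace ℝ (Fin N) × ℝ → ℝ} {ε R : ℝ}
    (hf : ContinuousOn f (Set.univ ×ˢ Set.Ici ε)) (hR : ∀ p, R < ‖p‖ → f p = 0) :
    IntegrableOn f (Set.univ ×ˢ Set.Ioi ε) := by
  have hcl : IsClosed (Set.univ ×ˢ Set.Ici ε : Set (EuclideanSpace ℝ (Fin N) × ℝ)) :=
    isClosed_univ.prod isClosed_Ici
  have hK : IsCompact (closedBall (0 : EuclideanSpace ℝ (Fin N) × ℝ) R ∩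
      Set.univ ×ˢ Set.Ici ε) := (isCompact_closedBall 0 R).inter_right hcl
  refine ((hf.mono inter_subset_right).integrableOn_compact hK).of_forall_sdiff_eq_zero
    (MeasurableSet.univ.prod measurableSet_Ioi) fun p hp => hR p ?_
  by_contra h
  refine hp.2 ⟨by simpa using h, trivial, ?_⟩
  exact (show ε < p.2 from hp.1.2).le

theorem integral_green_slice_eq_zero {φ : EuclideanSpace ℝ (Fin N) × ℝ → ℝ}
    (hφ : ContDiff ℝ (⊤ : ℕ∞) φ) {R : ℝ} (hR : ∀ p, R < ‖p‖ → φ p = 0) {t : ℝ} (ht : 0 < t) :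
    ∫ z, (csKernel N m (z, t) * spaceLaplacian N φ (z, t)
      - φ (z, t) * csKernelLaplacian N m (z, t)) = 0 := by
  have hcs : ∀ g : EuclideanSpace ℝ (Fin N) × ℝ → ℝ, (∀ p, R < ‖p‖ → g p = 0) →
      ∀ z : EuclideanSpace ℝ (Fin N), z ∉ closedBall 0 R → g (z, t) = 0 := fun g hg z hz =>
    hg _ (lt_of_lt_of_le (by simpa using hz) (le_max_left ‖z‖ ‖t‖))
  let e : Fin N → EuclideanSpace ℝ (Fin N) × ℝ := fun i => (EuclideanSpace.single i (1 : ℝ), 0)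
  let K : ℝ → EuclideanSpace ℝ (Fin N) → ℝ := fun a z => (‖z‖ ^ 2 + t ^ 2) ^ a
  have hKc : ∀ a, Continuous (K a) := fun a => continuous_rpow_quadratic a ht
  let W : Fin N → EuclideanSpace ℝ (Fin N) → ℝ := fun i z =>
    K (-m) z * dirDeriv (e i) φ (z, t) - φ (z, t) * (2 * (-m) * z i * K (-m - 1) z)
  let W' : Fin N → EuclideanSpace ℝ (Fin N) → ℝ := fun i z =>
    K (-m) z * dirDeriv (e i) (dirDeriv (e i) φ) (z, t)
      - φ (z, t) * (-2 * m * K (-m - 1) z + 4 * m * (m + 1) * (z i) ^ 2 * K (-m - 2) z)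
  have hpair : Continuous fun z : EuclideanSpace ℝ (Fin N) => (z, t) := by fun_prop
  have c0 := hφ.continuous.comp hpair
  have c1 := fun i => (hφ.dirDeriv (e i)).continuous.comp hpair
  have c2 := fun i => ((hφ.dirDeriv (e i)).dirDeriv (e i)).continuous.comp hpair
  have hW : ∀ i, Integrable (W i) := fun i => by
    refine Continuous.integrable_of_hasCompactSupport ?_
      (HasCompactSupport.intro (isCompact_closedBall 0 R) fun z hz => ?_)
    · have := hKc (-m); have := hKc (-m - 1); have := c1 i
      simp only [Function.comp_def] at *
      fun_prop
    · simp [W, hcs φ hR z hz, hcs _ (dirDeriv_eq_zero hR (e i)) z hz]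
  have hW' : ∀ i, Integrable (W' i) := fun i => by
    refine Continuous.integrable_of_hasCompactSupport ?_
      (HasCompactSupport.intro (isCompact_closedBall 0 R) fun z hz => ?_)
    · have := hKc (-m); have := hKc (-m - 1); have := hKc (-m - 2); have := c2 i
      simp only [Function.comp_def] at *
      fun_prop
    · simp [W', hcs φ hR z hz,
        hcs _ (dirDeriv_eq_zero (dirDeriv_eq_zero hR (e i)) (e i)) z hz]
  have hd : ∀ i z, HasLineDerivAt ℝ (W i) (W' i z) z (EuclideanSpace.single i 1) := fun i z => by
    have line : ∀ g : EuclideanSpace ℝ (Fin N) × ℝ → ℝ, ContDiff ℝ (⊤ : ℕ∞) g →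
        HasDerivAt (fun σ : ℝ => g (z + σ • EuclideanSpace.single i (1 : ℝ), t))
          (dirDeriv (e i) g (z, t)) 0 := fun g hg => by
      simpa [e] using hasDerivAt_line hg (e i) (z, t) 0
    have h1 := (hasDerivAt_rpow_quadratic_space (-m) z i ht).mul (line _ (hφ.dirDeriv (e i)))
    have h2 := (line _ hφ).mul (((hasDerivAt_coord z i).const_mul (2 * (-m))).mul
      (hasDerivAt_rpow_quadratic_space (-m - 1) z i ht))
    refine (h1.sub h2).congr_deriv ?_
    simp only [W', K, zero_smul, add_zero, Pi.mul_apply, show -m - 1 - 1 = -m - 2 by ring]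
    ring
  have key : ∀ i, ∫ z, W' i z = 0 := fun i =>
    integral_eq_zero_of_hasLineDerivAt (hW i) (hW' i) (hd i)
  rw [← Finset.sum_eq_zero (s := Finset.univ) fun i _ => key i,
    ← integral_finsetSum _ fun i _ => hW' i]
  refine integral_congr_ae (.of_forall fun z => ?_)
  simp only [W', K, csKernel, csKernelLaplacian, spaceLaplacian, Finset.sum_sub_distrib,
    ← Finset.mul_sum, Finset.sum_add_distrib, Finset.sum_const, Finset.card_univ, Fintype.card_fin,
    nsmul_eq_mul, ← Finset.sum_mul, ← EuclideanSpace.real_norm_sq_eq, e]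
  ring

/-- The conormal derivative of the fundamental solution on the slice `t`. -/
def conormal (N : ℕ) (s m : ℝ) (p : EuclideanSpace ℝ (Fin N) × ℝ) : ℝ :=
  2 * s * (‖p.1‖ ^ 2 + p.2 ^ 2) ^ (-m) - 2 * m * p.2 ^ 2 * (‖p.1‖ ^ 2 + p.2 ^ 2) ^ (-m - 1)

theorem hasDerivAt_flux (hm : 2 * m = N + 2 * s) {φ : EuclideanSpace ℝ (Fin N) × ℝ → ℝ}
    (hφ : ContDiff ℝ (⊤ : ℕ∞) φ) (z : EuclideanSpace ℝ (Fin N)) {t : ℝ} (ht : 0 < t) :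
    HasDerivAt (fun τ => τ * csKernel N m (z, τ) * dirDeriv (0, 1) φ (z, τ)
        - conormal N s m (z, τ) * φ (z, τ))
      (csKernel N m (z, t) * (t * dirDeriv (0, 1) (dirDeriv (0, 1) φ) (z, t)
        + (1 - 2 * s) * dirDeriv (0, 1) φ (z, t)) + t * (φ (z, t) * csKernelLaplacian N m (z, t)))
      t := by
  have hK := hasDerivAt_rpow_quadratic_time (-m) ‖z‖ ht
  have hK1 := hasDerivAt_rpow_quadratic_time (-m - 1) ‖z‖ ht
  have h1 := ((hasDerivAt_id t).mul hK).mul (hasDerivAt_snd (hφ.dirDeriv (0, 1)) z t)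
  have h2 := ((hK.const_mul (2 * s)).sub
    (((hasDerivAt_pow 2 t).const_mul (2 * m)).mul hK1)).mul (hasDerivAt_snd hφ z t)
  refine (h1.sub h2).congr_deriv ?_
  have hr : 0 < ‖z‖ ^ 2 + t ^ 2 := by positivity
  have e2 : (‖z‖ ^ 2 + t ^ 2) ^ (-m - 1) = (‖z‖ ^ 2 + t ^ 2) * (‖z‖ ^ 2 + t ^ 2) ^ (-m - 2) := by
    nth_rewrite 2 [← Real.rpow_one (‖z‖ ^ 2 + t ^ 2)]
    rw [← Real.rpow_add hr]; congr 1; ring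
  have e1 : (‖z‖ ^ 2 + t ^ 2) ^ (-m)
      = (‖z‖ ^ 2 + t ^ 2) * ((‖z‖ ^ 2 + t ^ 2) * (‖z‖ ^ 2 + t ^ 2) ^ (-m - 2)) := by
    rw [← e2]
    nth_rewrite 2 [← Real.rpow_one (‖z‖ ^ 2 + t ^ 2)]
    rw [← Real.rpow_add hr]; congr 1; ring
  have hs : s = m - N / 2 := by linarith
  simp only [csKernel, csKernelLaplacian, Pi.mul_apply, Pi.sub_apply, id,
    show -m - 1 - 1 = -m - 2 by ring, e1, e2, hs]
  push_cast
  ring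

theorem restrict_halfSpace (ε : ℝ) :
    (volume : Measure (EuclideanSpace ℝ (Fin N) × ℝ)).restrict (Set.univ ×ˢ Set.Ioi ε)
      = (volume : Measure (EuclideanSpace ℝ (Fin N))).prod (volume.restrict (Set.Ioi ε)) := by
  rw [Measure.volume_eq_prod, ← Measure.prod_restrict, Measure.restrict_univ]

/-- Green's formula on `{t > ε}`. -/
theorem integral_truncated_halfSpace (hm : 2 * m = N + 2 * s)
    {φ : EuclideanSpace ℝ (Fin N) × ℝ → ℝ}
    (hφ : ContDiff ℝ (⊤ : ℕ∞) φ) {R : ℝ} (hR : ∀ p, R < ‖p‖ → φ p = 0) {ε : ℝ} (hε : 0 < ε) :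
    ∫ p in Set.univ ×ˢ Set.Ioi ε, csKernel N m p * weightedDiv N s φ p
      = ∫ z, (conormal N s m (z, ε) * φ (z, ε)
        - ε * csKernel N m (z, ε) * dirDeriv (0, 1) φ (z, ε)) := by
  let P : EuclideanSpace ℝ (Fin N) × ℝ → ℝ := fun p =>
    csKernel N m p * (p.2 * dirDeriv (0, 1) (dirDeriv (0, 1) φ) p
        + (1 - 2 * s) * dirDeriv (0, 1) φ p) + p.2 * (φ p * csKernelLaplacian N m p)
  let Q : EuclideanSpace ℝ (Fin N) × ℝ → ℝ := fun p =>
    p.2 * (csKernel N m p * spaceLaplacian N φ p - φ p * csKernelLaplacian N m p)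
  have k0 := continuousOn_rpow_quadratic (N := N) (-m) hε
  have k1 := continuousOn_rpow_quadratic (N := N) (-m - 1) hε
  have k2 := continuousOn_rpow_quadratic (N := N) (-m - 2) hε
  have d1 := (hφ.dirDeriv (0, 1)).continuous
  have d2 := ((hφ.dirDeriv (0, 1)).dirDeriv (0, 1)).continuous
  have d3 := (spaceLaplacian_contDiff hφ).continuous
  have d0 := hφ.continuous
  have hP : IntegrableOn P (Set.univ ×ˢ Set.Ioi ε) := by
    refine integrableOn_halfSpace (R := R) ?_ fun p hp => ?_
    · unfold P csKernel csKernelLaplacian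
      fun_prop
    · simp [P, hR p hp, dirDeriv_eq_zero hR _ p hp,
        dirDeriv_eq_zero (dirDeriv_eq_zero hR _) _ p hp]
  have hQ : IntegrableOn Q (Set.univ ×ˢ Set.Ioi ε) := by
    refine integrableOn_halfSpace (R := R) ?_ fun p hp => ?_
    · unfold Q csKernel csKernelLaplacian
      fun_prop
    · simp [Q, hR p hp, spaceLaplacian_eq_zero hR p hp]
  have hPQ : ∀ p, csKernel N m p * weightedDiv N s φ p = P p + Q p := fun p => by
    simp only [P, Q, weightedDiv]; ring
  simp only [hPQ]
  rw [integral_add hP hQ]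
  have hP' := hP
  rw [IntegrableOn, restrict_halfSpace] at hP hQ
  rw [restrict_halfSpace, integral_prod_symm Q hQ, integral_prod P hP]
  have hQ0 : ∫ t in Set.Ioi ε, ∫ z, Q (z, t) = 0 := by
    refine (setIntegral_congr_fun measurableSet_Ioi fun t (ht : ε < t) => ?_).trans
      (integral_zero _ _)
    simp only [Q]
    rw [integral_const_mul, integral_green_slice_eq_zero hφ hR (hε.trans ht), mul_zero]
  rw [hQ0, add_zero]
  refine integral_congr_ae ?_
  filter_upwards [hP.prod_right_ae] with z hz
  have hlim : Tendsto (fun τ => τ * csKernel N m (z, τ) * dirDeriv (0, 1) φ (z, τ)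
        - conormal N s m (z, τ) * φ (z, τ)) atTop (𝓝 0) := by
    refine tendsto_const_nhds.congr' ?_
    filter_upwards [eventually_gt_atTop R] with t ht
    have hn : R < ‖(z, t)‖ := ht.trans_le ((le_abs_self t).trans (le_max_right ‖z‖ ‖t‖))
    simp [hR _ hn, dirDeriv_eq_zero hR _ _ hn]
  have := integral_Ioi_of_hasDerivAt_of_tendsto' (a := ε)
    (fun t (ht : ε ≤ t) => hasDerivAt_flux (s := s) hm hφ z (hε.trans_le ht)) hz hlim
  refine Eq.trans this ?_
  ring

end HalfSpace

theorem exists_lipschitz_min_bound {F : Type*} [NormedAddCommGroup F] {f : F → ℝ} {L : NNReal}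
    (hL : LipschitzWith L f) {C : ℝ} (hC : ∀ p, |f p| ≤ C) :
    ∃ B, 0 ≤ B ∧ ∀ p q, |f p - f q| ≤ B * min 1 ‖p - q‖ := by
  refine ⟨max (2 * C) L, le_max_of_le_right L.coe_nonneg, fun p q => ?_⟩
  rw [mul_min_of_nonneg _ _ (le_max_of_le_right L.coe_nonneg)]
  refine le_min ?_ ?_
  · rw [mul_one]
    refine le_max_of_le_left ((abs_sub _ _).trans ?_)
    linarith [hC p, hC q]
  · have := hL.dist_le_mul p q
    rw [Real.dist_eq, dist_eq_norm] at this
    exact this.trans (by gcongr; exact le_max_right _ _)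

section HalfSpaceLimit

variable {N : ℕ} {s m : ℝ}

theorem abs_conormal_le (hs : 0 ≤ s) (hm : 0 ≤ m) (z : EuclideanSpace ℝ (Fin N)) {t : ℝ}
    (ht : 0 < t) : |conormal N s m (z, t)| ≤ (2 * s + 2 * m) * csKernel N m (z, t) := by
  have hr : 0 < ‖z‖ ^ 2 + t ^ 2 := by positivity
  have e1 : (‖z‖ ^ 2 + t ^ 2) ^ (-m) = (‖z‖ ^ 2 + t ^ 2) * (‖z‖ ^ 2 + t ^ 2) ^ (-m - 1) := by
    nth_rewrite 2 [← Real.rpow_one (‖z‖ ^ 2 + t ^ 2)]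
    rw [← Real.rpow_add hr]; congr 1; ring
  have hb : 0 < (‖z‖ ^ 2 + t ^ 2) ^ (-m - 1) := Real.rpow_pos_of_pos hr _
  simp only [conormal, csKernel, e1]
  have h1 : 0 ≤ s * ((‖z‖ ^ 2 + t ^ 2) * (‖z‖ ^ 2 + t ^ 2) ^ (-m - 1)) := by positivity
  have h2 : 0 ≤ m * (‖z‖ ^ 2 * (‖z‖ ^ 2 + t ^ 2) ^ (-m - 1)) := by positivity
  have h3 : 0 ≤ m * (t ^ 2 * (‖z‖ ^ 2 + t ^ 2) ^ (-m - 1)) := by positivity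
  rw [abs_le]; constructor <;> nlinarith

/-- `(|z|² + t²)^(-m)` is, up to constants, a fundamental solution on the half space. -/
theorem integral_halfSpace (hN : 1 ≤ N) (hs0 : 0 < s) (hs : s < 1 / 2) (hm : 2 * m = N + 2 * s)
    {φ : EuclideanSpace ℝ (Fin N) × ℝ → ℝ}
    (hφ : ContDiff ℝ (⊤ : ℕ∞) φ) {R : ℝ} (hR : ∀ p, R < ‖p‖ → φ p = 0) :
    ∫ p in Set.univ ×ˢ Set.Ioi (0 : ℝ), csKernel N m p * weightedDiv N s φ p
      = 2 * s * ∫ z, ‖z‖ ^ (-(2 * m)) * (φ (z, 0) - φ (0, 0)) := by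
  have : Nonempty (Fin N) := ⟨⟨0, hN⟩⟩
  have hN' : (1 : ℝ) ≤ N := by exact_mod_cast hN
  have hm2 : 1 / 2 < m := by linarith
  have hm0 : 0 < m := by linarith
  have hint := integrable_csKernel_mul hm0 (by linarith) (weightedDiv_continuous (s := s) hφ)
    (weightedDiv_eq_zero hR)
  have lim1 : Tendsto (fun ε => ∫ p in Set.univ ×ˢ Set.Ioi ε, csKernel N m p * weightedDiv N s φ p)
      (𝓝[>] 0) (𝓝 (∫ p in Set.univ ×ˢ Set.Ioi (0 : ℝ),
        csKernel N m p * weightedDiv N s φ p)) := by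
    have hms : ∀ ε : ℝ, MeasurableSet (Set.univ ×ˢ Set.Ioi ε :
        Set (EuclideanSpace ℝ (Fin N) × ℝ)) := fun ε => MeasurableSet.univ.prod measurableSet_Ioi
    simp only [← integral_indicator (hms _)]
    refine tendsto_integral_filter_of_dominated_convergence
      (fun p => ‖csKernel N m p * weightedDiv N s φ p‖)
      (.of_forall fun ε => hint.aestronglyMeasurable.indicator (hms ε))
      (.of_forall fun ε => .of_forall fun p => norm_indicator_le_norm_self _ _) hint.norm
      (.of_forall fun p => ?_)
    refine tendsto_const_nhds.congr' ?_
    by_cases hp : 0 < p.2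
    · filter_upwards [mem_nhdsWithin_of_mem_nhds (Iio_mem_nhds hp)] with ε (hε : ε < p.2)
      rw [Set.indicator_of_mem (show p ∈ Set.univ ×ˢ Set.Ioi 0 from ⟨trivial, hp⟩),
        Set.indicator_of_mem (show p ∈ Set.univ ×ˢ Set.Ioi ε from ⟨trivial, hε⟩)]
    · filter_upwards [self_mem_nhdsWithin] with ε (hε : 0 < ε)
      rw [Set.indicator_of_notMem (a := p) (s := Set.univ ×ˢ Set.Ioi 0)
          fun h => hp h.2,
        Set.indicator_of_notMem (a := p) (s := Set.univ ×ˢ Set.Ioi ε)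
          fun h => hp (hε.trans h.2)]
  obtain ⟨C, hC0, hC⟩ := exists_bound_of_zero_outside hφ.continuous hR
  obtain ⟨C', hC'0, hC'⟩ := exists_bound_of_zero_outside (hφ.dirDeriv (0, 1)).continuous
    (dirDeriv_eq_zero hR (0, 1))
  have hcs : HasCompactSupport φ := HasCompactSupport.intro (isCompact_closedBall 0 R)
    fun p hp => hR p (by simpa using hp)
  obtain ⟨L, hL⟩ := hφ.lipschitzWith_of_hasCompactSupport hcs (by simp)
  obtain ⟨B, hB0, hB⟩ := exists_lipschitz_min_bound hL hC
  let G : ℝ → EuclideanSpace ℝ (Fin N) → ℝ := fun ε z =>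
    conormal N s m (z, ε) * (φ (z, ε) - φ (0, ε))
      - ε * csKernel N m (z, ε) * dirDeriv (0, 1) φ (z, ε)
  have hGm : ∀ ε, AEStronglyMeasurable (G ε) := fun ε => by
    have c0 := hφ.continuous.measurable
    have c1 := (hφ.dirDeriv (0, 1)).continuous.measurable
    refine Measurable.aestronglyMeasurable ?_
    unfold G conormal csKernel
    fun_prop
  have hdom := (integrable_min_mul_norm_rpow (volume : Measure (EuclideanSpace ℝ (Fin N)))
    (q := 2 * m) (by simp; linarith) (by simp; linarith)).const_mul ((2 * s + 2 * m) * B + C')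
  have hbd : ∀ ε : ℝ, 0 < ε → ε ≤ 1 → ∀ᵐ z, ‖G ε z‖
      ≤ ((2 * s + 2 * m) * B + C') * (min 1 ‖z‖ * ‖z‖ ^ (-(2 * m))) := fun ε hε hε1 => by
    filter_upwards [Measure.ae_ne volume (0 : EuclideanSpace ℝ (Fin N))] with z hz
    have h1 := abs_conormal_le (N := N) hs0.le hm0.le z hε
    have h2 := csKernel_le_space hm0 hz ε
    have h3 : |φ (z, ε) - φ (0, ε)| ≤ B * min 1 ‖z‖ := by
      simpa [Prod.norm_def] using hB (z, ε) (0, ε)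
    have h4 := mul_csKernel_le hm2 hz hε hε1
    have h5 := csKernel_nonneg (N := N) (m := m) (z, ε)
    calc ‖G ε z‖ ≤ |conormal N s m (z, ε)| * |φ (z, ε) - φ (0, ε)|
          + ε * csKernel N m (z, ε) * |dirDeriv (0, 1) φ (z, ε)| := by
          refine (norm_sub_le _ _).trans (le_of_eq ?_)
          rw [norm_mul, norm_mul, Real.norm_eq_abs, Real.norm_eq_abs, Real.norm_eq_abs,
            Real.norm_eq_abs, abs_of_nonneg (mul_nonneg hε.le h5)]
      _ ≤ ((2 * s + 2 * m) * ‖z‖ ^ (-(2 * m))) * (B * min 1 ‖z‖)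
          + (min 1 ‖z‖ * ‖z‖ ^ (-(2 * m))) * C' := by
          gcongr
          · exact h1.trans (by gcongr)
          · exact hC' _
      _ = _ := by ring
  have hsmall : ∀ᶠ ε : ℝ in 𝓝[>] 0, 0 < ε ∧ ε ≤ 1 := by
    filter_upwards [Ioc_mem_nhdsGT (zero_lt_one (α := ℝ))] with ε hε using hε
  have lim2 : Tendsto (fun ε => ∫ z, G ε z) (𝓝[>] 0)
      (𝓝 (∫ z, 2 * s * (‖z‖ ^ (-(2 * m)) * (φ (z, 0) - φ (0, 0))))) := by
    refine tendsto_integral_filter_of_dominated_convergence _ (.of_forall hGm)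
      (hsmall.mono fun ε hε => hbd ε hε.1 hε.2) hdom ?_
    filter_upwards [Measure.ae_ne volume (0 : EuclideanSpace ℝ (Fin N))] with z hz
    have hz0 : 0 < ‖z‖ := norm_pos_iff.2 hz
    have c0 := hφ.continuous
    have c1 := (hφ.dirDeriv (0, 1)).continuous
    have hc : ∀ a : ℝ, Continuous fun ε : ℝ => (‖z‖ ^ 2 + ε ^ 2) ^ a := fun a => by
      have h1 : Continuous fun ε : ℝ => ‖z‖ ^ 2 + ε ^ 2 := by fun_prop
      exact h1.rpow_const fun ε => Or.inl (by positivity)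
    have hk := hc (-m)
    have hk1 := hc (-m - 1)
    have hG : Continuous fun ε => G ε z := by
      unfold G conormal csKernel
      fun_prop
    have h0 : G 0 z = 2 * s * (‖z‖ ^ (-(2 * m)) * (φ (z, 0) - φ (0, 0))) := by
      rw [show -(2 * m) = (2 : ℕ) * (-m) by push_cast; ring, Real.rpow_mul hz0.le,
        Real.rpow_natCast]
      simp [G, conormal]
      ring
    rw [← h0]
    exact (hG.tendsto 0).mono_left nhdsWithin_le_nhds
  rw [← integral_const_mul]
  refine tendsto_nhds_unique lim1 (lim2.congr' ?_)
  filter_upwards [hsmall] with ε hε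
  rw [integral_truncated_halfSpace hm hφ hR hε.1]
  obtain ⟨hci, hc0⟩ := integral_conormal_eq_zero
    (volume : Measure (EuclideanSpace ℝ (Fin N))) (s := s) (m := m) hs0 (by simpa using hm) hε.1
  have hGi : Integrable (G ε) := hdom.mono' (hGm ε) (hbd ε hε.1 hε.2)
  have : ∀ z, conormal N s m (z, ε) * φ (z, ε) - ε * csKernel N m (z, ε) * dirDeriv (0, 1) φ (z, ε)
      = G ε z + (2 * s * (‖z‖ ^ 2 + ε ^ 2) ^ (-m)
      - 2 * m * ε ^ 2 * (‖z‖ ^ 2 + ε ^ 2) ^ (-m - 1)) * φ (0, ε) := fun z => by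
    simp only [G, conormal]; ring
  simp only [this]
  rw [integral_add hGi (hci.mul_const _), integral_mul_const, hc0]
  simp

end HalfSpaceLimit

theorem weightedDiv_comp_add_right {N : ℕ} (s : ℝ) (φ : EuclideanSpace ℝ (Fin N) × ℝ → ℝ)
    (y : EuclideanSpace ℝ (Fin N)) (p : EuclideanSpace ℝ (Fin N) × ℝ) :
    weightedDiv N s (fun q => φ (q + (y, 0))) p = weightedDiv N s φ (p + (y, 0)) := by
  simp only [weightedDiv, spaceLaplacian, dirDeriv_comp_add_right]
  simp

/-- Symmetry of the bilinear form of the fractional Laplacian. -/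
theorem integral_fracLaplacian_symm {F : Type*} [NormedAddCommGroup F] [NormedSpace ℝ F]
    [MeasurableSpace F] [BorelSpace F] [FiniteDimensional ℝ F] [Nontrivial F]
    (μ : Measure F) [μ.IsAddHaarMeasure] {q : ℝ} (hq : Module.finrank ℝ F < q)
    (hq' : q < Module.finrank ℝ F + 1) {u w : F → ℝ} (hu : Continuous u)
    (huc : HasCompactSupport u) (hw : Continuous w) (hwc : HasCompactSupport w) {B B' : ℝ}
    (hB : ∀ x y, |u x - u y| ≤ B * min 1 ‖x - y‖)
    (hB' : ∀ x y, |w x - w y| ≤ B' * min 1 ‖x - y‖) :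
    ∫ x, (∫ z, ‖z‖ ^ (-q) * (u x - u (x - z)) ∂μ) * w x ∂μ
      = -∫ y, u y * (∫ z, ‖z‖ ^ (-q) * (w (z + y) - w y) ∂μ) ∂μ := by
  have hk := integrable_min_mul_norm_rpow μ hq hq'
  have hwi := hw.integrable_of_hasCompactSupport hwc (μ := μ)
  have hui := hu.integrable_of_hasCompactSupport huc (μ := μ)
  have i1 : Integrable (Function.uncurry fun x z => ‖z‖ ^ (-q) * (u x - u (x - z)) * w x)
      (μ.prod μ) := by
    refine ((hwi.norm.mul_prod hk).const_mul B).mono' ?_ (.of_forall fun p => ?_)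
    · refine Measurable.aestronglyMeasurable ?_
      have := hu.measurable; have := hw.measurable
      unfold Function.uncurry
      fun_prop
    · have h := hB p.1 (p.1 - p.2)
      rw [sub_sub_cancel] at h
      have h0 : 0 ≤ ‖p.2‖ ^ (-q) := Real.rpow_nonneg (norm_nonneg _) _
      simp only [Function.uncurry, norm_mul, Real.norm_of_nonneg h0]
      calc ‖p.2‖ ^ (-q) * ‖u p.1 - u (p.1 - p.2)‖ * ‖w p.1‖
          ≤ ‖p.2‖ ^ (-q) * (B * min 1 ‖p.2‖) * ‖w p.1‖ := by gcongr; exact h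
        _ = _ := by ring
  have i2 : Integrable (Function.uncurry fun y z => u y * (‖z‖ ^ (-q) * (w (z + y) - w y)))
      (μ.prod μ) := by
    refine ((hui.norm.mul_prod hk).const_mul B').mono' ?_ (.of_forall fun p => ?_)
    · refine Measurable.aestronglyMeasurable ?_
      have := hu.measurable; have := hw.measurable
      unfold Function.uncurry
      fun_prop
    · have h := hB' (p.2 + p.1) p.1
      rw [add_sub_cancel_right] at h
      have h0 : 0 ≤ ‖p.2‖ ^ (-q) := Real.rpow_nonneg (norm_nonneg _) _
      simp only [Function.uncurry, norm_mul, Real.norm_of_nonneg h0]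
      calc ‖u p.1‖ * (‖p.2‖ ^ (-q) * ‖w (p.2 + p.1) - w p.1‖)
          ≤ ‖u p.1‖ * (‖p.2‖ ^ (-q) * (B' * min 1 ‖p.2‖)) := by gcongr; exact h
        _ = _ := by ring
  simp only [← integral_mul_const, ← integral_const_mul]
  rw [integral_integral_swap i1, integral_integral_swap i2, ← integral_neg]
  refine integral_congr_ae (.of_forall fun z => ?_)
  have j0 : Integrable (fun x => u x * w x) μ :=
    (hu.mul hw).integrable_of_hasCompactSupport huc.mul_right
  have j1 : Integrable (fun x => u (x - z) * w x) μ :=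
    ((hu.comp (continuous_id.sub continuous_const)).mul hw).integrable_of_hasCompactSupport
      hwc.mul_left
  have j2 : Integrable (fun x => u x * w (z + x)) μ :=
    (hu.mul (hw.comp (continuous_const.add continuous_id))).integrable_of_hasCompactSupport
      huc.mul_right
  have e1 : ∀ x, ‖z‖ ^ (-q) * (u x - u (x - z)) * w x
      = ‖z‖ ^ (-q) * (u x * w x - u (x - z) * w x) := fun x => by ring
  have e2 : ∀ x, u x * (‖z‖ ^ (-q) * (w (z + x) - w x))
      = ‖z‖ ^ (-q) * (u x * w (z + x) - u x * w x) := fun x => by ring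
  simp only [e1, e2]
  rw [integral_const_mul, integral_const_mul, integral_sub j0 j1, integral_sub j2 j0,
    ← integral_sub_right_eq_self (fun x => u x * w (z + x)) z]
  simp only [add_sub_cancel]
  ring

/-- The principal value in the fractional Laplacian of a Lipschitz function of order `< 1` is an
absolutely convergent integral. -/
theorem tendsto_fracLaplacian {F : Type*} [NormedAddCommGroup F] [NormedSpace ℝ F]
    [MeasurableSpace F] [BorelSpace F] [FiniteDimensional ℝ F] [Nontrivial F]
    (μ : Measure F) [μ.IsAddHaarMeasure] {q : ℝ} (hq : Module.finrank ℝ F < q)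
    (hq' : q < Module.finrank ℝ F + 1) {u : F → ℝ} (hu : Continuous u) {B : ℝ}
    (hB : ∀ x y, |u x - u y| ≤ B * min 1 ‖x - y‖) (x : F) :
    Tendsto (fun ε : ℝ => ∫ y in {y : F | ε ≤ ‖y - x‖}, (u x - u y) * ‖x - y‖ ^ (-q) ∂μ)
      (𝓝[>] (0 : ℝ)) (𝓝 (∫ z, ‖z‖ ^ (-q) * (u x - u (x - z)) ∂μ)) := by
  have hk := ((integrable_min_mul_norm_rpow μ hq hq').comp_sub_left x).const_mul B
  have hms : ∀ ε : ℝ, MeasurableSet {y : F | ε ≤ ‖y - x‖} := fun ε =>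
    measurableSet_le measurable_const (by fun_prop)
  have hm : AEStronglyMeasurable (fun y => (u x - u y) * ‖x - y‖ ^ (-q)) μ := by
    have := hu.measurable
    exact Measurable.aestronglyMeasurable (by fun_prop)
  rw [← integral_sub_left_eq_self _ μ x]
  simp only [← integral_indicator (hms _), sub_sub_cancel]
  refine tendsto_integral_filter_of_dominated_convergence _
    (.of_forall fun ε => hm.indicator (hms ε))
    (.of_forall fun ε => .of_forall fun y => (norm_indicator_le_norm_self _ _).trans ?_) hk ?_
  · have h0 : 0 ≤ ‖x - y‖ ^ (-q) := Real.rpow_nonneg (norm_nonneg _) _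
    rw [norm_mul, Real.norm_of_nonneg h0, ← mul_assoc]
    exact mul_le_mul_of_nonneg_right (hB x y) h0
  · filter_upwards [Measure.ae_ne μ x] with y hy
    refine tendsto_const_nhds.congr' ?_
    have : 0 < ‖y - x‖ := norm_pos_iff.2 (sub_ne_zero.2 hy)
    filter_upwards [mem_nhdsWithin_of_mem_nhds (Iio_mem_nhds this)] with ε (hε : ε < ‖y - x‖)
    rw [Set.indicator_of_mem (show y ∈ {y : F | ε ≤ ‖y - x‖} from hε.le), mul_comm]

section Extension

variable {N : ℕ} {s m : ℝ}

instance : (volume : Measure (EuclideanSpace ℝ (Fin N) × ℝ)).IsAddRightInvariant :=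
  inferInstanceAs
    ((volume : Measure (EuclideanSpace ℝ (Fin N))).prod (volume : Measure ℝ)).IsAddRightInvariant

theorem integrable_extension_integrand (hm0 : 0 < m) (hm : 2 * m < N + 1)
    {u : EuclideanSpace ℝ (Fin N) → ℝ} (hu : Continuous u) (huc : HasCompactSupport u)
    {f : EuclideanSpace ℝ (Fin N) × ℝ → ℝ} (hf : Continuous f) {R : ℝ}
    (hR : ∀ p, R < ‖p‖ → f p = 0) :
    Integrable (Function.uncurry fun (p : EuclideanSpace ℝ (Fin N) × ℝ) y =>
      u y * (csKernel N m (p.1 - y, p.2) * f p)) (volume.prod volume) := by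
  obtain ⟨C, hC0, hC⟩ := exists_bound_of_zero_outside hf hR
  obtain ⟨Ru, hRu0, hRu⟩ := huc.exists_pos_le_norm
  let k : EuclideanSpace ℝ (Fin N) × ℝ → ℝ := fun p =>
    C * (Set.Iic (R + Ru)).indicator (fun r : ℝ => r ^ (-(2 * m))) ‖p‖
  have hk : Integrable k := (integrable_truncated_norm hm (R + Ru)).const_mul C
  have hkm : Measurable k := by
    have : Measurable ((Set.Iic (R + Ru)).indicator (fun r : ℝ => r ^ (-(2 * m)))) :=
      Measurable.indicator (by fun_prop) measurableSet_Iic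
    exact (this.comp measurable_norm).const_mul C
  have hk0 : ∀ p, 0 ≤ k p := fun p => mul_nonneg hC0
    (Set.indicator_apply_nonneg fun _ => Real.rpow_nonneg (norm_nonneg _) _)
  have hui := hu.integrable_of_hasCompactSupport huc (μ := volume)
  have hum := hu.measurable
  have hfm := hf.measurable
  have hKm := measurable_csKernel (N := N) (m := m)
  have hdom : Integrable (fun r : EuclideanSpace ℝ (Fin N) × (EuclideanSpace ℝ (Fin N) × ℝ) =>
      u r.1 * k (r.2 - (r.1, 0))) (volume.prod volume) := by
    rw [integrable_prod_iff (Measurable.aestronglyMeasurable (by fun_prop))]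
    refine ⟨.of_forall fun y => (hk.comp_sub_right (y, 0)).const_mul (u y), ?_⟩
    have : ∀ y, ∫ p, ‖u y * k (p - (y, 0))‖ = ‖u y‖ * ∫ p, ‖k p‖ := fun y => by
      simp only [norm_mul]
      rw [integral_const_mul, integral_sub_right_eq_self (fun p => ‖k p‖) (y, (0 : ℝ))]
    simp only [this]
    exact hui.norm.mul_const _
  refine Integrable.mono hdom.swap (Measurable.aestronglyMeasurable ?_) (.of_forall fun r => ?_)
  · unfold Function.uncurry
    fun_prop
  · rcases r with ⟨p, y⟩
    simp only [Function.uncurry, Function.comp, Prod.swap, norm_mul (u y)]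
    by_cases hy : Ru ≤ ‖y‖
    · simp [hRu y hy]
    refine mul_le_mul_of_nonneg_left ?_ (norm_nonneg _)
    rw [Real.norm_of_nonneg (hk0 _)]
    have e : (p.1 - y, p.2) = p - (y, 0) := by ext <;> simp
    rw [e]
    refine csKernel_mul_le hm0 hC0 hC hR _ _ fun h => (norm_sub_le _ _).trans (add_le_add h ?_)
    simpa [Prod.norm_def, hRu0.le] using (not_le.1 hy).le

theorem integral_extension_halfSpace (hN : 1 ≤ N) (hs0 : 0 < s) (hs : s < 1 / 2)
    (hm : 2 * m = N + 2 * s)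
    {u : EuclideanSpace ℝ (Fin N) → ℝ} (hu : Continuous u) (huc : HasCompactSupport u)
    {φ : EuclideanSpace ℝ (Fin N) × ℝ → ℝ}
    (hφ : ContDiff ℝ (⊤ : ℕ∞) φ) {R : ℝ} (hR : ∀ p, R < ‖p‖ → φ p = 0) :
    ∫ p in Set.univ ×ˢ Set.Ioi (0 : ℝ), ∫ y, u y * (csKernel N m (p.1 - y, p.2)
        * weightedDiv N s φ p)
      = 2 * s * ∫ y, u y * ∫ z, ‖z‖ ^ (-(2 * m)) * (φ (z + y, 0) - φ (y, 0)) := by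
  have hN' : (1 : ℝ) ≤ N := by exact_mod_cast hN
  have hint := integrable_extension_integrand (by linarith) (by linarith) hu huc
    (weightedDiv_continuous (s := s) hφ) (weightedDiv_eq_zero hR) (m := m)
  have hms : MeasurableSet (Set.univ ×ˢ Set.Ioi 0 : Set (EuclideanSpace ℝ (Fin N) × ℝ)) :=
    MeasurableSet.univ.prod measurableSet_Ioi
  rw [integral_integral_swap (hint.mono_measure
    (Measure.prod_mono Measure.restrict_le_self le_rfl)), ← integral_const_mul]
  refine integral_congr_ae (.of_forall fun y => ?_)
  have hφy : ContDiff ℝ (⊤ : ℕ∞) fun q : EuclideanSpace ℝ (Fin N) × ℝ => φ (q + (y, 0)) :=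
    hφ.comp (contDiff_id.add contDiff_const)
  have hRy : ∀ q : EuclideanSpace ℝ (Fin N) × ℝ, R + ‖(y, (0 : ℝ))‖ < ‖q‖ →
      φ (q + (y, 0)) = 0 := fun q hq => hR _ (by
    have := norm_sub_norm_le q (-(y, (0 : ℝ)))
    rw [norm_neg, sub_neg_eq_add] at this
    linarith)
  have key := integral_halfSpace hN hs0 hs hm hφy hRy
  simp only [weightedDiv_comp_add_right, Prod.mk_add_mk, add_zero, zero_add] at key
  dsimp only
  rw [integral_const_mul, mul_left_comm, ← key, ← integral_indicator hms, ← integral_indicator hms,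
    ← integral_add_right_eq_self _ (y, (0 : ℝ))]
  congr 1
  refine integral_congr_ae (.of_forall fun p => ?_)
  simp only [Set.indicator_apply, Set.mem_prod, Set.mem_univ, true_and, Prod.snd_add, add_zero,
    Prod.fst_add, add_sub_cancel_right]

/-- The weighted divergence `div(|t|^{1-2s} ∇φ)`. -/
def divWeightGrad (N : ℕ) (s : ℝ) (φ : EuclideanSpace ℝ (Fin N) × ℝ → ℝ)
    (p : EuclideanSpace ℝ (Fin N) × ℝ) : ℝ :=
  |p.2| ^ (1 - 2 * s) * (∑ i : Fin N, iteratedDeriv 2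
      (fun σ : ℝ => φ (p.1 + σ • EuclideanSpace.single i (1 : ℝ), p.2)) 0)
    + deriv (fun τ : ℝ => |τ| ^ (1 - 2 * s) * deriv (fun τ' : ℝ => φ (p.1, τ')) τ) p.2

theorem divWeightGrad_of_pos {φ : EuclideanSpace ℝ (Fin N) × ℝ → ℝ}
    (hφ : ContDiff ℝ (⊤ : ℕ∞) φ) {p : EuclideanSpace ℝ (Fin N) × ℝ} (hp : 0 < p.2) :
    p.2 ^ (2 * s) * divWeightGrad N s φ p = weightedDiv N s φ p := by
  have e1 : ∀ i : Fin N, iteratedDeriv 2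
      (fun σ : ℝ => φ (p.1 + σ • EuclideanSpace.single i (1 : ℝ), p.2)) 0
      = dirDeriv (EuclideanSpace.single i 1, 0) (dirDeriv (EuclideanSpace.single i 1, 0) φ) p :=
    fun i => by
      rw [← iteratedDeriv_two_line hφ]
      congr 1
      ext σ
      congr 1
      ext <;> simp
  have e2 : (fun τ : ℝ => |τ| ^ (1 - 2 * s) * deriv (fun τ' : ℝ => φ (p.1, τ')) τ)
      =ᶠ[𝓝 p.2] fun τ => τ ^ (1 - 2 * s) * dirDeriv (0, 1) φ (p.1, τ) := by
    filter_upwards [Ioi_mem_nhds hp] with τ (hτ : 0 < τ)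
    rw [abs_of_pos hτ, (hasDerivAt_snd hφ p.1 τ).deriv]
  have e3 := ((Real.hasDerivAt_rpow_const (p := 1 - 2 * s) (.inl hp.ne')).mul
    (hasDerivAt_snd (hφ.dirDeriv (0, 1)) p.1 p.2)).deriv
  rw [divWeightGrad, e2.deriv_eq, weightedDiv, spaceLaplacian, abs_of_pos hp]
  simp only [e1]
  erw [e3]
  have h1 : p.2 ^ (2 * s) * p.2 ^ (1 - 2 * s) = p.2 := by
    rw [← Real.rpow_add hp]; simp
  have h2 : p.2 ^ (2 * s) * p.2 ^ (1 - 2 * s - 1) = 1 := by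
    rw [← Real.rpow_add hp]
    ring_nf
    simp
  simp only [Prod.mk.eta]
  linear_combination (∑ i : Fin N, dirDeriv (EuclideanSpace.single i 1, 0)
      (dirDeriv (EuclideanSpace.single i 1, 0) φ) p + dirDeriv (0, 1) (dirDeriv (0, 1) φ) p) * h1
    + (1 - 2 * s) * dirDeriv (0, 1) φ p * h2

theorem csExt_mul_divWeightGrad (hm : 2 * m = N + 2 * s) (u : EuclideanSpace ℝ (Fin N) → ℝ)
    {φ : EuclideanSpace ℝ (Fin N) × ℝ → ℝ} (hφ : ContDiff ℝ (⊤ : ℕ∞) φ)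
    {p : EuclideanSpace ℝ (Fin N) × ℝ} (hp : 0 < p.2) :
    csExt N s u p.1 p.2 * divWeightGrad N s φ p
      = pNs N s * ∫ y, u y * (csKernel N m (p.1 - y, p.2) * weightedDiv N s φ p) := by
  have e : -((N : ℝ) + 2 * s) / 2 = -m := by linarith
  simp only [← mul_assoc, integral_mul_const]
  rw [← divWeightGrad_of_pos hφ hp, csExt, abs_of_pos hp, e]
  simp only [csKernel]
  ring

theorem csExt_neg (N : ℕ) (s : ℝ) (u : EuclideanSpace ℝ (Fin N) → ℝ)
    (x : EuclideanSpace ℝ (Fin N)) (t : ℝ) : csExt N s u x (-t) = csExt N s u x t := by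
  simp [csExt]

theorem divWeightGrad_reflect (N : ℕ) (s : ℝ) (φ : EuclideanSpace ℝ (Fin N) × ℝ → ℝ)
    (x : EuclideanSpace ℝ (Fin N)) (t : ℝ) :
    divWeightGrad N s (fun q => φ (q.1, -q.2)) (x, t) = divWeightGrad N s φ (x, -t) := by
  simp only [divWeightGrad, abs_neg]
  congr 1
  have h : (fun τ : ℝ => |τ| ^ (1 - 2 * s) * deriv (fun τ' : ℝ => φ (x, -τ')) τ)
      = fun τ => -((fun τ : ℝ => |τ| ^ (1 - 2 * s) * deriv (fun τ' : ℝ => φ (x, τ')) τ) (-τ)) := by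
    ext τ
    rw [deriv_comp_neg (fun τ' => φ (x, τ'))]
    simp
  rw [h, deriv.fun_neg, deriv_comp_neg
    (fun τ : ℝ => |τ| ^ (1 - 2 * s) * deriv (fun τ' : ℝ => φ (x, τ')) τ), neg_neg]

theorem two_mul_pNs_mul (hs0 : 0 < s) (hs : s < 1 / 2) :
    pNs N s * (2 * s) = cNs N s / dCS s := by
  have g1 := Real.Gamma_pos_of_pos hs0
  have g2 := Real.Gamma_pos_of_pos (show 0 < 1 - s by linarith)
  have hpi : Real.pi ^ (-(N : ℝ) / 2) = (Real.pi ^ ((N : ℝ) / 2))⁻¹ := by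
    rw [neg_div, Real.rpow_neg Real.pi_pos.le]
  have h2 : (2 : ℝ) ^ (2 * s) = 2 * 2 ^ (2 * s - 1) := by
    rw [Real.rpow_sub_one two_ne_zero]; ring
  have e : ((N : ℝ) + 2 * s) / 2 = N / 2 + s := by ring
  have h3 : (0 : ℝ) < 2 ^ (2 * s - 1) := by positivity
  have h4 : 0 < Real.pi ^ ((N : ℝ) / 2) := by positivity
  rw [pNs, cNs, dCS, hpi, h2, e]
  field_simp

theorem integral_upper_csExt (hN : 1 ≤ N) (hs0 : 0 < s) (hs : s < 1 / 2)
    {u : EuclideanSpace ℝ (Fin N) → ℝ} (hu : ContDiff ℝ 2 u) (huc : HasCompactSupport u)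
    {Lsu : EuclideanSpace ℝ (Fin N) → ℝ}
    (hLs : ∀ x : EuclideanSpace ℝ (Fin N),
      Tendsto (fun ε : ℝ =>
          cNs N s * ∫ y in {y : EuclideanSpace ℝ (Fin N) | ε ≤ ‖y - x‖},
            (u x - u y) * ‖x - y‖ ^ (-(N : ℝ) - 2 * s))
        (𝓝[>] (0 : ℝ)) (𝓝 (Lsu x)))
    {φ : EuclideanSpace ℝ (Fin N) × ℝ → ℝ}
    (hφ : ContDiff ℝ (⊤ : ℕ∞) φ) {R : ℝ} (hR : ∀ p, R < ‖p‖ → φ p = 0) :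
    IntegrableOn (fun p => csExt N s u p.1 p.2 * divWeightGrad N s φ p)
        (Set.univ ×ˢ Set.Ioi (0 : ℝ)) ∧
      ∫ p in Set.univ ×ˢ Set.Ioi (0 : ℝ), csExt N s u p.1 p.2 * divWeightGrad N s φ p
        = -(1 / dCS s) * ∫ x, Lsu x * φ (x, 0) := by
  have hN' : (1 : ℝ) ≤ N := by exact_mod_cast hN
  obtain ⟨m, hm⟩ : ∃ m : ℝ, 2 * m = N + 2 * s := ⟨(N + 2 * s) / 2, by ring⟩
  have hms : MeasurableSet (Set.univ ×ˢ Set.Ioi 0 : Set (EuclideanSpace ℝ (Fin N) × ℝ)) :=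
    MeasurableSet.univ.prod measurableSet_Ioi
  have hcongr : Set.EqOn (fun p => csExt N s u p.1 p.2 * divWeightGrad N s φ p)
      (fun p => pNs N s * ∫ y, u y * (csKernel N m (p.1 - y, p.2) * weightedDiv N s φ p))
      (Set.univ ×ˢ Set.Ioi (0 : ℝ)) := fun p hp => csExt_mul_divWeightGrad hm u hφ hp.2
  have hint := integrable_extension_integrand (by linarith) (by linarith) hu.continuous huc
    (weightedDiv_continuous (s := s) hφ) (weightedDiv_eq_zero hR) (m := m)
  refine ⟨((hint.integral_prod_left.const_mul (pNs N s)).integrableOn).congr_fun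
    (fun p hp => (hcongr hp).symm) hms, ?_⟩
  have : Nonempty (Fin N) := ⟨⟨0, hN⟩⟩
  have hq : (Module.finrank ℝ (EuclideanSpace ℝ (Fin N)) : ℝ) < 2 * m := by
    rw [finrank_euclideanSpace_fin]; linarith
  have hq' : 2 * m < (Module.finrank ℝ (EuclideanSpace ℝ (Fin N)) : ℝ) + 1 := by
    rw [finrank_euclideanSpace_fin]; linarith
  have hw : ContDiff ℝ (⊤ : ℕ∞) fun x : EuclideanSpace ℝ (Fin N) => φ (x, 0) :=
    hφ.comp (contDiff_id.prodMk contDiff_const)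
  have hwc : HasCompactSupport fun x : EuclideanSpace ℝ (Fin N) => φ (x, 0) := by
    refine HasCompactSupport.intro (isCompact_closedBall 0 R) fun x hx => hR _ ?_
    rw [mem_closedBall_zero_iff, not_le] at hx
    simpa [Prod.norm_def] using hx
  have lip : ∀ {v : EuclideanSpace ℝ (Fin N) → ℝ}, ContDiff ℝ 2 v → HasCompactSupport v →
      ∃ B, ∀ x y, |v x - v y| ≤ B * min 1 ‖x - y‖ := fun {v} hv hvc => by
    obtain ⟨L, hL⟩ := hv.lipschitzWith_of_hasCompactSupport hvc (by norm_num)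
    obtain ⟨C, hC⟩ := hvc.exists_bound_of_continuous hv.continuous
    obtain ⟨B, -, hB⟩ := exists_lipschitz_min_bound hL hC
    exact ⟨B, hB⟩
  obtain ⟨B, hB⟩ := lip hu huc
  obtain ⟨B', hB'⟩ := lip (hw.of_le (by norm_cast)) hwc
  have hL : ∀ x, Lsu x = cNs N s * ∫ z, ‖z‖ ^ (-(2 * m)) * (u x - u (x - z)) := fun x => by
    refine tendsto_nhds_unique (hLs x) ?_
    have := (tendsto_fracLaplacian volume hq hq' hu.continuous hB x).const_mul (cNs N s)
    rwa [show -(2 * m) = -(N : ℝ) - 2 * s by linarith] at this ⊢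
  have hsymm := integral_fracLaplacian_symm volume hq hq' hu.continuous huc hw.continuous hwc hB hB'
  rw [setIntegral_congr_fun hms hcongr, integral_const_mul,
    integral_extension_halfSpace hN hs0 hs hm hu.continuous huc hφ hR]
  simp only [hL, mul_assoc (cNs N s)]
  rw [integral_const_mul, hsymm, ← mul_assoc, two_mul_pNs_mul hs0 hs]
  ring

end Extension

/-- the Caffarelli–Silvestre extension satisfies
`−div(|t|^{1−2s} ∇w_s) = (2/d_s) [(−Δ)^s u] ℒ^N ⊗ δ_0` in `ℝ^{N+1}`
in the distributional sense. Here `Lsu` is the pointwise fractional Laplacian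
`(−Δ)^s u`, encoded through the hypothesis `hLs`. -/
theorem stmt18 (N : ℕ) (hN : 1 ≤ N) (s : ℝ) (hs0 : 0 < s) (hs : s < 1 / 2)
    (u : EuclideanSpace ℝ (Fin N) → ℝ)
    (hu : ContDiff ℝ 2 u) (huc : HasCompactSupport u)
    (Lsu : EuclideanSpace ℝ (Fin N) → ℝ)
    (hLs : ∀ x : EuclideanSpace ℝ (Fin N),
      Tendsto (fun ε : ℝ =>
          cNs N s * ∫ y in {y : EuclideanSpace ℝ (Fin N) | ε ≤ ‖y - x‖},
            (u x - u y) * ‖x - y‖ ^ (-(N : ℝ) - 2 * s))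
        (𝓝[>] (0 : ℝ)) (𝓝 (Lsu x)))
    (φ : EuclideanSpace ℝ (Fin N) × ℝ → ℝ)
    (hφ : ContDiff ℝ (⊤ : ℕ∞) φ) (hφc : HasCompactSupport φ) :
    (∫ p : EuclideanSpace ℝ (Fin N) × ℝ,
        csExt N s u p.1 p.2 *
          (|p.2| ^ (1 - 2 * s) * (∑ i : Fin N, iteratedDeriv 2
              (fun σ : ℝ => φ (p.1 + σ • EuclideanSpace.single i (1 : ℝ), p.2)) 0)
            + deriv (fun τ : ℝ => |τ| ^ (1 - 2 * s) * deriv (fun τ' : ℝ => φ (p.1, τ')) τ) p.2))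
      = -(2 / dCS s) * ∫ x, Lsu x * φ (x, 0) := by
  change ∫ p, csExt N s u p.1 p.2 * divWeightGrad N s φ p = _
  obtain ⟨R, -, hR⟩ := hφc.exists_pos_le_norm
  obtain ⟨i1, e1⟩ := integral_upper_csExt hN hs0 hs hu huc hLs hφ fun p hp => hR p hp.le
  obtain ⟨i2, e2⟩ := integral_upper_csExt hN hs0 hs hu huc hLs
    (φ := fun q => φ (q.1, -q.2)) (R := R) (hφ.comp (contDiff_fst.prodMk contDiff_snd.neg))
    fun p hp => hR _ (by simpa [Prod.norm_def] using hp.le)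
  let ρ : EuclideanSpace ℝ (Fin N) × ℝ ≃ᵐ EuclideanSpace ℝ (Fin N) × ℝ :=
    (MeasurableEquiv.refl _).prodCongr (MeasurableEquiv.neg ℝ)
  have hρ : MeasurePreserving ρ volume volume :=
    (MeasurePreserving.id volume).prod (Measure.measurePreserving_neg volume)
  have hpre : ρ ⁻¹' (Set.univ ×ˢ Set.Iio 0) = Set.univ ×ˢ Set.Ioi 0 := by
    ext p
    simp [ρ, MeasurableEquiv.prodCongr]
  have hcomp : (fun p => csExt N s u p.1 p.2 * divWeightGrad N s (fun q => φ (q.1, -q.2)) p)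
      = (fun p => csExt N s u p.1 p.2 * divWeightGrad N s φ p) ∘ ρ := by
    ext ⟨x, t⟩
    rw [divWeightGrad_reflect, ← csExt_neg]
    rfl
  have hcompl : (Set.univ ×ˢ Set.Ioi 0 : Set (EuclideanSpace ℝ (Fin N) × ℝ))ᶜ
      = Set.univ ×ˢ Set.Iic 0 := by
    ext p
    simp
  have hae := Measure.set_prod_ae_eq (μ := (volume : Measure (EuclideanSpace ℝ (Fin N))))
    (ae_eq_refl Set.univ) (Iio_ae_eq_Iic (μ := (volume : Measure ℝ)) (a := 0)).symm
  rw [← Measure.volume_eq_prod] at hae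
  have hms : MeasurableSet (Set.univ ×ˢ Set.Ioi 0 : Set (EuclideanSpace ℝ (Fin N) × ℝ)) :=
    MeasurableSet.univ.prod measurableSet_Ioi
  rw [hcomp, ← hpre, hρ.integrableOn_comp_preimage ρ.measurableEmbedding] at i2
  rw [hcomp, ← hpre] at e2
  have e2' := (hρ.setIntegral_preimage_emb ρ.measurableEmbedding
    (fun p => csExt N s u p.1 p.2 * divWeightGrad N s φ p) (Set.univ ×ˢ Set.Iio 0)).symm.trans e2
  have i3 := i2.congr_set_ae hae
  rw [← setIntegral_congr_set hae] at e2'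
  have hi : Integrable fun p => csExt N s u p.1 p.2 * divWeightGrad N s φ p := by
    rw [← integrableOn_univ, ← Set.union_compl_self]
    exact i1.union (hcompl ▸ i3)
  rw [← integral_add_compl hms hi, hcompl, e1, e2']
  simp only [neg_zero]
  ring
end
end
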